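/- arXiv:1008.3944 — 2 statements merged into one kernel-verified Lean document; each statement's English description precedes it below -/
import Mathlib

section
/- Let d ≥ 4 and let K = {x ∈ ℝ^d : ‖x‖ ≤ 1, x_d ≥ 0} be the closed upper unit half-ball. Then for every integer k ≥ 1, E_{X_1,...,X_d ∈ K}((vol conv{0, X_1, ..., X_d})^k) < E(V_K^k), where X_1,...,X_d are independent uniformly random points in K and V_K is the volume of the convex hull of d+1 independent uniformly random points in K. -/
open MeasureTheory

/-- The `j`-th moment of the weight `√(1 - x ^ 2) ^ p` on `[0, 1]`. -/
noncomputable def capMoment (p j : ℕ) : ℝ := ∫ x in (0 : ℝ)..1, x ^ j * √(1 - x ^ 2) ^ p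

lemma hasDerivAt_sqrt_one_sub_sq_pow (p : ℕ) {x : ℝ} (hx : x ∈ Set.Ioo (0 : ℝ) 1) :
    HasDerivAt (fun x : ℝ => √(1 - x ^ 2) ^ (p + 2)) (-((p + 2) * (x * √(1 - x ^ 2) ^ p))) x := by
  have h1 : 0 < 1 - x ^ 2 := by nlinarith [hx.1, hx.2]
  have h2 : HasDerivAt (fun x : ℝ => 1 - x ^ 2) (-(2 * x)) x := by
    simpa using ((hasDerivAt_id x).pow 2).const_sub 1
  refine ((h2.sqrt h1.ne').pow (p + 2)).congr_deriv ?_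
  have h3 : √(1 - x ^ 2) ≠ 0 := (Real.sqrt_pos.2 h1).ne'
  rw [show p + 2 - 1 = p + 1 from rfl, pow_succ]
  push_cast
  field_simp

lemma capMoment_pos (p j : ℕ) : 0 < capMoment p j := by
  refine intervalIntegral.intervalIntegral_pos_of_pos_on
    (Continuous.intervalIntegrable (by fun_prop) _ _) (fun x hx => ?_) one_pos
  have h1 : 0 < 1 - x ^ 2 := by nlinarith [hx.1, hx.2]
  have := hx.1
  positivity

lemma capMoment_add_two (p j : ℕ) :
    ((p : ℝ) + j + 3) * capMoment p (j + 2) = (j + 1) * capMoment p j := by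
  have h : ∫ x in (0 : ℝ)..1, ((j + 1) * (x ^ j * √(1 - x ^ 2) ^ p)
      - (p + j + 3) * (x ^ (j + 2) * √(1 - x ^ 2) ^ p)) = 0 := by
    rw [intervalIntegral.integral_eq_sub_of_hasDerivAt_of_le (zero_le_one)
      (f := fun x : ℝ => x ^ (j + 1) * √(1 - x ^ 2) ^ (p + 2)) (by fun_prop) _
      (Continuous.intervalIntegrable (by fun_prop) _ _)]
    · simp
    · intro x hx
      have h1 : 0 ≤ 1 - x ^ 2 := by nlinarith [hx.1, hx.2]
      refine ((hasDerivAt_pow (j + 1) x).mul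
        (hasDerivAt_sqrt_one_sub_sq_pow p hx)).congr_deriv ?_
      rw [pow_add _ p 2, Real.sq_sqrt h1]
      push_cast
      ring
  rw [intervalIntegral.integral_sub (Continuous.intervalIntegrable (by fun_prop) _ _)
    (Continuous.intervalIntegrable (by fun_prop) _ _), intervalIntegral.integral_const_mul,
    intervalIntegral.integral_const_mul] at h
  unfold capMoment
  linarith

lemma capMoment_add_two_zero (p : ℕ) :
    ((p : ℝ) + 3) * capMoment (p + 2) 0 = (p + 2) * capMoment p 0 := by
  have h1 : capMoment (p + 2) 0 = capMoment p 0 - capMoment p 2 := by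
    unfold capMoment
    rw [← intervalIntegral.integral_sub (Continuous.intervalIntegrable (by fun_prop) _ _)
      (Continuous.intervalIntegrable (by fun_prop) _ _)]
    refine intervalIntegral.integral_congr fun x hx => ?_
    rw [Set.uIcc_of_le zero_le_one] at hx
    have h1 : 0 ≤ 1 - x ^ 2 := by nlinarith [hx.1, hx.2]
    simp only [pow_add _ p 2, Real.sq_sqrt h1]
    ring
  have h2 := capMoment_add_two p 0
  simp only [zero_add, Nat.cast_zero, add_zero, one_mul] at h2
  rw [h1]
  linarith

lemma capMoment_one (p : ℕ) : capMoment p 1 = 1 / (p + 2) := by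
  have h : ∫ x in (0 : ℝ)..1, (-((p + 2) * (x * √(1 - x ^ 2) ^ p))) = -1 := by
    rw [intervalIntegral.integral_eq_sub_of_hasDerivAt_of_le (zero_le_one)
      (f := fun x : ℝ => √(1 - x ^ 2) ^ (p + 2)) (by fun_prop)
      (fun x hx => hasDerivAt_sqrt_one_sub_sq_pow p hx)
      (Continuous.intervalIntegrable (by fun_prop) _ _)]
    simp
  rw [intervalIntegral.integral_neg, intervalIntegral.integral_const_mul] at h
  rw [eq_div_iff (by positivity)]
  simp only [capMoment, pow_one]
  linarith

lemma capMoment_sq_mul_le (a s : ℕ) :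
    capMoment a 0 ^ 2 * (2 * a + 3) ≤ capMoment (a + 2 * s) 0 ^ 2 * (2 * a + 4 * s + 3) := by
  induction s with
  | zero => simp
  | succ s ih =>
    refine ih.trans ?_
    have h := capMoment_add_two_zero (a + 2 * s)
    rw [show a + 2 * (s + 1) = a + 2 * s + 2 by ring]
    set I := capMoment (a + 2 * s) 0
    set I' := capMoment (a + 2 * s + 2) 0
    push_cast at h ⊢
    set x : ℝ := (a : ℝ) + 2 * s
    have hx : 0 ≤ x := by positivity
    have h' : I' = (x + 2) / (x + 3) * I := by field_simp; linarith
    have key : (2 * x + 3) ≤ ((x + 2) / (x + 3)) ^ 2 * (2 * x + 7) := by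
      rw [div_pow, div_mul_eq_mul_div, le_div_iff₀ (by positivity)]
      nlinarith
    calc I ^ 2 * (2 * a + 4 * s + 3) = I ^ 2 * (2 * x + 3) := by simp only [x]; ring
      _ ≤ I ^ 2 * (((x + 2) / (x + 3)) ^ 2 * (2 * x + 7)) := by gcongr
      _ = I' ^ 2 * (2 * a + 4 * (s + 1) + 3) := by rw [h']; simp only [x]; ring

lemma sum_ge_of_ratio {T : ℕ → ℝ} {q : ℕ} (hq : 1 ≤ q) {c e : ℝ}
    (h1 : (3 * c * q + e) * T 0 ≤ T 1)
    (he : 0 ≤ e * T 0)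
    (hT : ∀ i, 1 ≤ i → i < q → 3 * ((q : ℝ) - i) * T i ≤ (i + 1) * T (i + 1)) :
    (c * 4 ^ q + 1 - c + e) * T 0 ≤ ∑ i ∈ Finset.range (q + 1), T i := by
  have h2 : ∀ i, i < q → c * (q.choose (i + 1)) * 3 ^ (i + 1) * T 0 ≤ T (i + 1) := by
    intro i
    induction i with
    | zero =>
      intro _
      simp only [zero_add, Nat.choose_one_right, pow_one]
      linarith
    | succ i ih =>
      intro hi
      have h3 := hT (i + 1) (by omega) hi
      have h4 := ih (by omega)
      have h5 : (q.choose (i + 1 + 1) : ℝ) * (i + 1 + 1) = q.choose (i + 1) * (q - (i + 1)) := by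
        have := Nat.choose_succ_right_eq q (i + 1)
        have h6 : ((q - (i + 1) : ℕ) : ℝ) = q - (i + 1) := by
          rw [Nat.cast_sub (by omega)]; push_cast; ring
        rw [← h6]
        exact_mod_cast this
      have h7 : (0 : ℝ) ≤ (q : ℝ) - (i + 1) := by
        have : (i : ℝ) + 1 ≤ q := by exact_mod_cast (by omega : i + 1 ≤ q)
        linarith
      push_cast at h3
      have h8 : 0 < (i : ℝ) + 1 + 1 := by positivity
      refine le_of_mul_le_mul_left ?_ h8
      calc ((i : ℝ) + 1 + 1) * (c * (q.choose (i + 1 + 1)) * 3 ^ (i + 1 + 1) * T 0)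
          = c * (q.choose (i + 1 + 1) * (i + 1 + 1)) * 3 ^ (i + 1 + 1) * T 0 := by ring
        _ = 3 * (q - (i + 1)) * (c * q.choose (i + 1) * 3 ^ (i + 1) * T 0) := by rw [h5]; ring
        _ ≤ 3 * (q - (i + 1)) * T (i + 1) := by gcongr
        _ ≤ _ := h3
  obtain ⟨r, rfl⟩ : ∃ r, q = r + 1 := ⟨q - 1, by omega⟩
  have h9 : ∑ i ∈ Finset.range (r + 1 + 1), ((r + 1).choose i : ℝ) * 3 ^ i = 4 ^ (r + 1) := by
    have := add_pow (3 : ℝ) 1 (r + 1)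
    norm_num at this
    rw [this]
    exact Finset.sum_congr rfl fun i _ => mul_comm _ _
  rw [Finset.sum_range_succ', Finset.sum_range_succ'] at h9 ⊢
  have h10 : ∑ i ∈ Finset.range r, c * ((r + 1).choose (i + 1 + 1)) * 3 ^ (i + 1 + 1) * T 0
      ≤ ∑ i ∈ Finset.range r, T (i + 1 + 1) :=
    Finset.sum_le_sum fun i hi => h2 (i + 1) (by have := Finset.mem_range.1 hi; omega)
  have h11 : ∑ i ∈ Finset.range r, c * ((r + 1).choose (i + 1 + 1)) * 3 ^ (i + 1 + 1) * T 0
      = c * T 0 * ∑ i ∈ Finset.range r, ((r + 1).choose (i + 1 + 1) : ℝ) * 3 ^ (i + 1 + 1) := by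
    rw [Finset.mul_sum]
    exact Finset.sum_congr rfl fun i _ => by ring
  simp only [zero_add, Nat.choose_one_right, pow_one, Nat.choose_zero_right, Nat.cast_one,
    pow_zero, one_mul] at h9
  have h12 := eq_sub_of_add_eq (eq_sub_of_add_eq h9)
  rw [h11, h12] at h10
  simp only [zero_add]
  push_cast at h1 h10 ⊢
  linarith

/-- The summands of even index in the expansion of the `k`-th mixed moment. -/
noncomputable def evenTerm (n k i : ℕ) : ℝ :=
  k.choose (2 * i) * (capMoment (n * (n + k + 2)) (k - 2 * i) * capMoment n (2 * i))

lemma evenTerm_pos {n k i : ℕ} (h : 2 * i ≤ k) : 0 < evenTerm n k i :=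
  mul_pos (by exact_mod_cast Nat.choose_pos h) (mul_pos (capMoment_pos _ _) (capMoment_pos _ _))

lemma evenTerm_succ {n k i : ℕ} (h : 2 * i + 2 ≤ k) :
    (2 * (i : ℝ) + 2) * (n + 2 * i + 3) * evenTerm n k (i + 1)
      = (k - 2 * i) * ((n + 1) * (n + 1 + k) - 2 * i) * evenTerm n k i := by
  obtain ⟨l, rfl⟩ : ∃ l, k = 2 * i + 2 + l := ⟨k - (2 * i + 2), by omega⟩
  unfold evenTerm
  have hc1 := Nat.choose_succ_right_eq (2 * i + 2 + l) (2 * i)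
  have hc2 := Nat.choose_succ_right_eq (2 * i + 2 + l) (2 * i + 1)
  rw [show 2 * i + 2 + l - 2 * i = l + 2 by omega] at hc1
  rw [show 2 * i + 2 + l - (2 * i + 1) = l + 1 by omega] at hc2
  have e1 := capMoment_add_two (n * (n + (2 * i + 2 + l) + 2)) l
  have e2 := capMoment_add_two n (2 * i)
  rw [show 2 * (i + 1) = 2 * i + 2 by ring, show 2 * i + 2 + l - (2 * i + 2) = l by omega,
    show 2 * i + 2 + l - 2 * i = l + 2 by omega]
  generalize capMoment (n * (n + (2 * i + 2 + l) + 2)) l = A0 at *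
  generalize capMoment (n * (n + (2 * i + 2 + l) + 2)) (l + 2) = A2 at *
  generalize capMoment n (2 * i) = B0 at *
  generalize capMoment n (2 * i + 2) = B2 at *
  have hc1' : ((2 * i + 2 + l).choose (2 * i + 1) : ℝ) * (2 * i + 1)
      = (2 * i + 2 + l).choose (2 * i) * (l + 2) := by exact_mod_cast hc1
  have hc2' : ((2 * i + 2 + l).choose (2 * i + 2) : ℝ) * (2 * i + 2)
      = (2 * i + 2 + l).choose (2 * i + 1) * (l + 1) := by exact_mod_cast hc2
  generalize ((2 * i + 2 + l).choose (2 * i + 2) : ℝ) = C2 at *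
  generalize ((2 * i + 2 + l).choose (2 * i + 1) : ℝ) = C1 at *
  generalize ((2 * i + 2 + l).choose (2 * i) : ℝ) = C0 at *
  push_cast at *
  have : (0 : ℝ) < (2 * i + 1) := by positivity
  refine mul_left_cancel₀ this.ne' ?_
  calc (2 * (i : ℝ) + 1) * ((2 * i + 2) * (n + 2 * i + 3) * (C2 * (A0 * B2)))
      = (2 * i + 1) * (C2 * (2 * i + 2)) * A0 * ((n + 2 * i + 3) * B2) := by ring
    _ = (C1 * (2 * i + 1)) * ((l + 1) * A0) * ((2 * i + 1) * B0) := by rw [hc2', e2]; ring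
    _ = _ := by rw [hc1', ← e1]; ring

lemma evenTerm_ratio {n k q i : ℕ} (hn : 3 ≤ n) (hq : 2 * q ≤ k) (hi : i < q) :
    3 * ((q : ℝ) - i) * evenTerm n k i ≤ (i + 1) * evenTerm n k (i + 1) := by
  have h := evenTerm_succ (n := n) (show 2 * i + 2 ≤ k by omega)
  have hT := evenTerm_pos (n := n) (show 2 * i ≤ k by omega)
  have hi' : (i : ℝ) + 1 ≤ q := by exact_mod_cast hi
  have hq' : 2 * (q : ℝ) ≤ k := by exact_mod_cast hq
  have hn' : (3 : ℝ) ≤ n := by exact_mod_cast hn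
  have hb : (0 : ℝ) < n + 2 * i + 3 := by positivity
  have hk : (2 : ℝ) ≤ k := by linarith [show (0 : ℝ) ≤ i from i.cast_nonneg]
  have key : 3 * ((n : ℝ) + 2 * i + 3) ≤ (n + 1) * (n + 1 + k) - 2 * i := by nlinarith
  refine le_of_mul_le_mul_left ?_ (mul_pos two_pos hb)
  calc 2 * ((n : ℝ) + 2 * i + 3) * (3 * (q - i) * evenTerm n k i)
      = (2 * q - 2 * i) * (3 * (n + 2 * i + 3)) * evenTerm n k i := by ring
    _ ≤ (k - 2 * i) * ((n + 1) * (n + 1 + k) - 2 * i) * evenTerm n k i := by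
        have : (0 : ℝ) ≤ k - 2 * i := by linarith
        gcongr
    _ = _ := by rw [← h]; ring

lemma evenTerm_one_ge {n k : ℕ} (hk : 2 ≤ k) {g : ℝ}
    (hg : g * (n + 3) ≤ (n + 1) * (n + 1 + k)) :
    (k / 2 * g) * evenTerm n k 0 ≤ evenTerm n k 1 := by
  have h := evenTerm_succ (n := n) (i := 0) (by omega : 2 * 0 + 2 ≤ k)
  have hT := evenTerm_pos (n := n) (show 2 * 0 ≤ k by omega)
  simp only [Nat.cast_zero, mul_zero, zero_add, add_zero, sub_zero] at h
  have hb : (0 : ℝ) < n + 3 := by positivity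
  refine le_of_mul_le_mul_left ?_ (mul_pos two_pos hb)
  rw [h]
  calc 2 * ((n : ℝ) + 3) * (k / 2 * g * evenTerm n k 0) = k * (g * (n + 3)) * evenTerm n k 0 := by
        ring
    _ ≤ _ := by gcongr

lemma two_pow_mul_lt_sum_evenTerm {n k : ℕ} (hn : 3 ≤ n) (hk : 2 ≤ k)
    (hnk : ¬ (n = 3 ∧ k = 3)) :
    2 ^ k * evenTerm n k 0 < ∑ i ∈ Finset.range (k / 2 + 1), evenTerm n k i := by
  have hT := evenTerm_pos (n := n) (show 2 * 0 ≤ k by omega)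
  have hn' : (3 : ℝ) ≤ n := by exact_mod_cast hn
  obtain ⟨q, rfl | rfl⟩ := k.even_or_odd'
  · have hq : 1 ≤ q := by omega
    have hq' : (1 : ℝ) ≤ q := by exact_mod_cast hq
    rw [show 2 * q / 2 = q by omega]
    have h1 := evenTerm_one_ge (n := n) (k := 2 * q) (g := 4) (by omega)
      (by push_cast; nlinarith)
    push_cast at h1
    have := sum_ge_of_ratio (T := evenTerm n (2 * q)) hq (c := 1) (e := q) (by linarith)
      (by positivity) (fun i _ hi => evenTerm_ratio hn le_rfl hi)
    refine lt_of_lt_of_le ?_ this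
    rw [pow_mul]
    norm_num
    nlinarith
  · have hq : 1 ≤ q := by omega
    have hq' : (1 : ℝ) ≤ q := by exact_mod_cast hq
    rw [show (2 * q + 1) / 2 = q by omega]
    have h1 : (3 * 2 * q + 2) * evenTerm n (2 * q + 1) 0 ≤ evenTerm n (2 * q + 1) 1 := by
      rcases Nat.lt_or_ge q 2 with h | h
      · obtain rfl : q = 1 := by omega
        have hn4 : (4 : ℝ) ≤ n := by exact_mod_cast (by omega : 4 ≤ n)
        have := evenTerm_one_ge (n := n) (k := 3) (g := 16 / 3) (by omega)
          (by push_cast; nlinarith)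
        push_cast at this ⊢
        linarith
      · have h' : (2 : ℝ) ≤ q := by exact_mod_cast h
        have := evenTerm_one_ge (n := n) (k := 2 * q + 1) (g := 6) (by omega)
          (by push_cast; nlinarith)
        push_cast at this
        refine le_trans ?_ this
        gcongr
        linarith
    have := sum_ge_of_ratio (T := evenTerm n (2 * q + 1)) hq (c := 2) (e := 2) h1
      (by positivity) (fun i _ hi => evenTerm_ratio hn (by omega) hi)
    refine lt_of_lt_of_le ?_ this
    rw [pow_succ, pow_mul]
    norm_num
    nlinarith

lemma setIntegral_unitSquare_mul (p n i j : ℕ) :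
    ∫ z in Set.Icc (0 : ℝ) 1 ×ˢ Set.Icc (0 : ℝ) 1,
      (z.1 ^ i * z.2 ^ j) * (√(1 - z.1 ^ 2) ^ p * √(1 - z.2 ^ 2) ^ n)
      = capMoment p i * capMoment n j := by
  have := setIntegral_prod_mul (μ := (volume : Measure ℝ)) (ν := (volume : Measure ℝ))
    (fun x : ℝ => x ^ i * √(1 - x ^ 2) ^ p) (fun x : ℝ => x ^ j * √(1 - x ^ 2) ^ n)
    (Set.Icc 0 1) (Set.Icc 0 1)
  unfold capMoment
  rw [intervalIntegral.integral_of_le zero_le_one, intervalIntegral.integral_of_le zero_le_one,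
    ← integral_Icc_eq_integral_Ioc, ← integral_Icc_eq_integral_Ioc, ← this, Measure.volume_eq_prod]
  exact integral_congr_ae (Filter.Eventually.of_forall fun z => by simp only; ring)

lemma integrableOn_unitSquare {f : ℝ × ℝ → ℝ} (hf : Continuous f) :
    IntegrableOn f (Set.Icc (0 : ℝ) 1 ×ˢ Set.Icc (0 : ℝ) 1) :=
  hf.continuousOn.integrableOn_compact (isCompact_Icc.prod isCompact_Icc)

/-- The symmetrized mixed moment `E |H + U| ^ k` up to normalization. -/
noncomputable def mixedMoment (k p n : ℕ) : ℝ :=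
  ∫ z in Set.Icc (0 : ℝ) 1 ×ˢ Set.Icc (0 : ℝ) 1,
    ((|z.1 + z.2| ^ k + |z.1 - z.2| ^ k) / 2) * (√(1 - z.1 ^ 2) ^ p * √(1 - z.2 ^ 2) ^ n)

lemma setIntegral_le_mixedMoment {k p n : ℕ} {f : ℝ × ℝ → ℝ} (hf : Continuous f)
    (h : ∀ x ∈ Set.Icc (0 : ℝ) 1, ∀ y ∈ Set.Icc (0 : ℝ) 1,
      f (x, y) ≤ (|x + y| ^ k + |x - y| ^ k) / 2) :
    ∫ z in Set.Icc (0 : ℝ) 1 ×ˢ Set.Icc (0 : ℝ) 1,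
      f z * (√(1 - z.1 ^ 2) ^ p * √(1 - z.2 ^ 2) ^ n) ≤ mixedMoment k p n := by
  refine setIntegral_mono_on (integrableOn_unitSquare (by fun_prop))
    (integrableOn_unitSquare (by fun_prop)) (measurableSet_Icc.prod measurableSet_Icc) ?_
  intro z hz
  have := h z.1 hz.1 z.2 hz.2
  gcongr

lemma sum_evenTerm_le_mixedMoment (n k : ℕ) :
    ∑ i ∈ Finset.range (k / 2 + 1), evenTerm n k i ≤ mixedMoment k (n * (n + k + 2)) n := by
  set p := n * (n + k + 2) with hp
  set c : ℕ → ℝ := fun j => (1 + (-1) ^ j) / 2 * k.choose j with hc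
  have hc0 : ∀ j, 0 ≤ c j := by
    intro j
    simp only [hc]
    rcases neg_one_pow_eq_or ℝ j with h | h <;> rw [h] <;> norm_num
  calc ∑ i ∈ Finset.range (k / 2 + 1), evenTerm n k i
      = ∑ j ∈ (Finset.range (k / 2 + 1)).image (2 * ·),
          c j * (capMoment p (k - j) * capMoment n j) := by
        rw [Finset.sum_image (fun a _ b _ h => by simpa using h)]
        refine Finset.sum_congr rfl fun i _ => ?_
        simp [evenTerm, hc, ← hp]
    _ ≤ ∑ j ∈ Finset.range (k + 1), c j * (capMoment p (k - j) * capMoment n j) := by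
        refine Finset.sum_le_sum_of_subset_of_nonneg ?_ fun j _ _ => ?_
        · intro j hj
          simp only [Finset.mem_image, Finset.mem_range] at hj ⊢
          omega
        · exact mul_nonneg (hc0 j)
            (mul_nonneg (capMoment_pos _ _).le (capMoment_pos _ _).le)
    _ = ∫ z in Set.Icc (0 : ℝ) 1 ×ˢ Set.Icc (0 : ℝ) 1,
          (((z.1 + z.2) ^ k + (z.1 - z.2) ^ k) / 2)
            * (√(1 - z.1 ^ 2) ^ p * √(1 - z.2 ^ 2) ^ n) := by
        simp_rw [← setIntegral_unitSquare_mul, ← integral_const_mul]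
        rw [← integral_finsetSum _ fun i _ => integrableOn_unitSquare (by fun_prop)]
        refine integral_congr_ae (Filter.Eventually.of_forall fun z => ?_)
        simp only [hc]
        rw [add_comm z.1 z.2, sub_eq_neg_add z.1 z.2, add_pow, add_pow, ← Finset.sum_add_distrib,
          Finset.sum_div, Finset.sum_mul]
        refine Finset.sum_congr rfl fun j _ => ?_
        rw [neg_pow]
        ring
    _ ≤ _ := by
        refine setIntegral_le_mixedMoment (f := fun z => ((z.1 + z.2) ^ k + (z.1 - z.2) ^ k) / 2)
          (by fun_prop) fun x _ y _ => ?_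
        rw [← abs_pow, ← abs_pow]
        have := le_abs_self ((x + y) ^ k)
        have := le_abs_self ((x - y) ^ k)
        linarith

lemma mixedMoment_three_three :
    2 ^ 3 * (capMoment 24 3 * capMoment 3 0) < mixedMoment 3 24 3 := by
  have h := setIntegral_le_mixedMoment (k := 3) (p := 24) (n := 3)
    (f := fun z => z.1 ^ 3 * z.2 ^ 0 + 3 * (z.1 ^ 1 * z.2 ^ 2)
      + (1 / 8) * (z.1 ^ 1 * z.2 ^ 6 - 3 * (z.1 ^ 3 * z.2 ^ 4) + 3 * (z.1 ^ 5 * z.2 ^ 2)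
        - z.1 ^ 7 * z.2 ^ 0)) (by fun_prop) (by
      rintro x ⟨hx0, hx1⟩ y ⟨hy0, hy1⟩
      rw [abs_of_nonneg (by positivity : 0 ≤ x + y)]
      have e : x * (y ^ 2 - x ^ 2) ^ 3 = (y - x) ^ 3 * (x * (x + y) ^ 3) := by ring
      have e1 : 0 ≤ x * (x + y) ^ 3 := by positivity
      rcases le_total x y with hxy | hxy
      · rw [abs_of_nonpos (by linarith)]
        have e2 : x * (x + y) ^ 3 ≤ 8 := by
          calc x * (x + y) ^ 3 ≤ 1 * (1 + 1) ^ 3 := by gcongr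
            _ = 8 := by norm_num
        have e3 : (y - x) ^ 3 * (x * (x + y) ^ 3) ≤ (y - x) ^ 3 * 8 := by
          have : 0 ≤ y - x := by linarith
          gcongr
        nlinarith
      · rw [abs_of_nonneg (by linarith)]
        have e3 : 0 ≤ (x - y) ^ 3 * (x * (x + y) ^ 3) := by
          have : 0 ≤ x - y := by linarith
          positivity
        nlinarith)
  have e : ∫ z in Set.Icc (0 : ℝ) 1 ×ˢ Set.Icc (0 : ℝ) 1,
      (z.1 ^ 3 * z.2 ^ 0 + 3 * (z.1 ^ 1 * z.2 ^ 2)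
      + (1 / 8) * (z.1 ^ 1 * z.2 ^ 6 - 3 * (z.1 ^ 3 * z.2 ^ 4) + 3 * (z.1 ^ 5 * z.2 ^ 2)
        - z.1 ^ 7 * z.2 ^ 0)) * (√(1 - z.1 ^ 2) ^ 24 * √(1 - z.2 ^ 2) ^ 3)
      = capMoment 24 3 * capMoment 3 0 + 3 * (capMoment 24 1 * capMoment 3 2)
      + (1 / 8) * (capMoment 24 1 * capMoment 3 6 - 3 * (capMoment 24 3 * capMoment 3 4)
        + 3 * (capMoment 24 5 * capMoment 3 2) - capMoment 24 7 * capMoment 3 0) := by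
    simp_rw [← setIntegral_unitSquare_mul]
    rw [← integral_const_mul, ← integral_const_mul, ← integral_const_mul,
      ← integral_sub, ← integral_add, ← integral_add, ← integral_sub, ← integral_const_mul,
      ← integral_add]
    · refine integral_congr_ae (Filter.Eventually.of_forall fun z => ?_)
      simp only
      ring
    all_goals exact integrableOn_unitSquare (by fun_prop)
  rw [e] at h
  have r1 := capMoment_add_two 24 1
  have r2 := capMoment_add_two 24 3
  have r3 := capMoment_add_two 24 5
  have s1 := capMoment_add_two 3 0
  have s2 := capMoment_add_two 3 2
  have s3 := capMoment_add_two 3 4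
  norm_num at r1 r2 r3 s1 s2 s3
  have hp := mul_pos (capMoment_pos 24 3) (capMoment_pos 3 0)
  have t1 : capMoment 24 1 = 14 * capMoment 24 3 := by linarith
  have t2 : capMoment 24 5 = 4 / 30 * capMoment 24 3 := by linarith
  have t3 : capMoment 24 7 = 1 / 40 * capMoment 24 3 := by linarith
  have u1 : capMoment 3 2 = 1 / 6 * capMoment 3 0 := by linarith
  have u2 : capMoment 3 4 = 1 / 16 * capMoment 3 0 := by linarith
  have u3 : capMoment 3 6 = 1 / 32 * capMoment 3 0 := by linarith
  rw [t1, t2, t3, u1, u2, u3] at h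
  nlinarith

lemma mixedMoment_one (p n : ℕ) :
    mixedMoment 1 p n = (1 / ((p : ℝ) + 2) + 1 / (n + 2)) * capMoment (p + n + 2) 0 := by
  set W : ℝ → ℝ := fun u => ∫ h in (0 : ℝ)..u, √(1 - h ^ 2) ^ p with hW
  have hWd : ∀ u, HasDerivAt W (√(1 - u ^ 2) ^ p) u := fun u =>
    intervalIntegral.integral_hasDerivAt_right (Continuous.intervalIntegrable (by fun_prop) _ _)
      (Continuous.stronglyMeasurableAtFilter (by fun_prop) _ _)
      (Continuous.continuousAt (by fun_prop))
  have hWc : Continuous W := continuous_iff_continuousAt.2 fun u => (hWd u).continuousAt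
  have hinner : ∀ u ∈ Set.Icc (0 : ℝ) 1, ∫ h in (0 : ℝ)..1,
      ((|h + u| ^ 1 + |h - u| ^ 1) / 2) * (√(1 - h ^ 2) ^ p * √(1 - u ^ 2) ^ n)
      = u * W u * √(1 - u ^ 2) ^ n + 1 / (p + 2) * √(1 - u ^ 2) ^ (p + n + 2) := by
    intro u hu
    have hu1 : 0 ≤ 1 - u ^ 2 := by nlinarith [hu.1, hu.2]
    rw [← intervalIntegral.integral_add_adjacent_intervals (b := u)
      (Continuous.intervalIntegrable (by fun_prop) _ _)
      (Continuous.intervalIntegrable (by fun_prop) _ _)]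
    congr 1
    · rw [hW, ← intervalIntegral.integral_const_mul, ← intervalIntegral.integral_mul_const]
      refine intervalIntegral.integral_congr fun h hh => ?_
      rw [Set.uIcc_of_le hu.1] at hh
      simp only [pow_one]
      rw [abs_of_nonneg (by linarith [hh.1, hu.1] : 0 ≤ h + u),
        abs_of_nonpos (by linarith [hh.2] : h - u ≤ 0)]
      ring
    · have e : ∫ h in u..1, (-((p + 2) * (h * √(1 - h ^ 2) ^ p))) = -√(1 - u ^ 2) ^ (p + 2) := by
        rw [intervalIntegral.integral_eq_sub_of_hasDerivAt_of_le hu.2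
          (f := fun x : ℝ => √(1 - x ^ 2) ^ (p + 2)) (by fun_prop)
          (fun x hx => hasDerivAt_sqrt_one_sub_sq_pow p ⟨hu.1.trans_lt hx.1, hx.2⟩)
          (Continuous.intervalIntegrable (by fun_prop) _ _)]
        simp
      calc ∫ h in u..1, ((|h + u| ^ 1 + |h - u| ^ 1) / 2) * (√(1 - h ^ 2) ^ p * √(1 - u ^ 2) ^ n)
          = ∫ h in u..1, (-√(1 - u ^ 2) ^ n / (p + 2)) * (-((p + 2) * (h * √(1 - h ^ 2) ^ p))) := by
            refine intervalIntegral.integral_congr fun h hh => ?_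
            rw [Set.uIcc_of_le hu.2] at hh
            simp only [pow_one]
            rw [abs_of_nonneg (by linarith [hh.1, hu.1] : 0 ≤ h + u),
              abs_of_nonneg (by linarith [hh.1] : 0 ≤ h - u)]
            field_simp
            ring
        _ = _ := by
            rw [intervalIntegral.integral_const_mul, e]
            field_simp
            ring
  have houter : ∫ u in (0 : ℝ)..1, ((n + 2) * (u * W u * √(1 - u ^ 2) ^ n)
      - √(1 - u ^ 2) ^ (p + n + 2)) = 0 := by
    rw [intervalIntegral.integral_eq_sub_of_hasDerivAt_of_le zero_le_one
      (f := fun u : ℝ => -(W u * √(1 - u ^ 2) ^ (n + 2))) (by fun_prop) (fun u hu => ?_)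
      (Continuous.intervalIntegrable (by fun_prop) _ _)]
    · simp [hW]
    · refine ((hWd u).mul (hasDerivAt_sqrt_one_sub_sq_pow n hu)).neg.congr_deriv ?_
      ring
  rw [intervalIntegral.integral_sub (Continuous.intervalIntegrable (by fun_prop) _ _)
    (Continuous.intervalIntegrable (by fun_prop) _ _), intervalIntegral.integral_const_mul,
    sub_eq_zero] at houter
  unfold mixedMoment
  rw [Measure.volume_eq_prod, ← Measure.prod_restrict, integral_prod_symm _ (by
    rw [Measure.prod_restrict]; exact integrableOn_unitSquare (by fun_prop))]
  simp only [integral_Icc_eq_integral_Ioc, ← intervalIntegral.integral_of_le (zero_le_one' ℝ)]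
  rw [intervalIntegral.integral_congr (g := fun u => u * W u * √(1 - u ^ 2) ^ n
      + 1 / (p + 2) * √(1 - u ^ 2) ^ (p + n + 2)) (fun u hu => by
        rw [Set.uIcc_of_le zero_le_one] at hu; exact hinner u hu),
    intervalIntegral.integral_add (Continuous.intervalIntegrable (by fun_prop) _ _)
    (Continuous.intervalIntegrable (by fun_prop) _ _), intervalIntegral.integral_const_mul]
  simp only [capMoment, pow_zero, one_mul]
  rw [← houter]
  field_simp
  ring

theorem two_pow_mul_capMoment_lt_mixedMoment {n k : ℕ} (hn : 3 ≤ n) (hk : 1 ≤ k) :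
    2 ^ k * (capMoment (n * (n + k + 2)) k * capMoment n 0)
      < mixedMoment k (n * (n + k + 2)) n := by
  rcases hk.eq_or_lt with rfl | hk
  · have hn' : (3 : ℝ) ≤ n := by exact_mod_cast hn
    rw [mixedMoment_one, capMoment_one]
    obtain ⟨s, hs⟩ : ∃ s, (n + 1) * (n + 2) = 2 * s :=
      (Nat.even_mul_succ_self (n + 1)).exists_two_nsmul _ |>.imp fun _ h => by simpa using h
    have hs' : ((n : ℝ) + 1) * (n + 2) = 2 * s := by exact_mod_cast hs
    have h := capMoment_sq_mul_le n s
    have e : n * (n + 1 + 2) + n + 2 = n + 2 * s := by rw [← hs]; ring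
    rw [e]
    have hI := capMoment_pos n 0
    have hI' := capMoment_pos (n + 2 * s) 0
    set I := capMoment n 0
    set I' := capMoment (n + 2 * s) 0
    have key : 2 * I < (n + 2) * I' := by
      refine lt_of_pow_lt_pow_left₀ 2 (by positivity) ?_
      have h3 : 4 * (2 * (n : ℝ) + 4 * s + 3) < (n + 2) ^ 2 * (2 * n + 3) := by
        have : 4 * (s : ℝ) = 2 * ((n + 1) * (n + 2)) := by rw [hs']; ring
        rw [this]
        nlinarith
      have h4 : (0 : ℝ) < 2 * n + 4 * s + 3 := by positivity
      refine lt_of_mul_lt_mul_right ?_ h4.le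
      calc (2 * I) ^ 2 * (2 * n + 4 * s + 3) = I ^ 2 * (4 * (2 * (n : ℝ) + 4 * s + 3)) := by ring
        _ < I ^ 2 * ((n + 2) ^ 2 * (2 * n + 3)) := by gcongr
        _ = (n + 2) ^ 2 * (I ^ 2 * (2 * n + 3)) := by ring
        _ ≤ (n + 2) ^ 2 * (I' ^ 2 * (2 * n + 4 * s + 3)) := by gcongr
        _ = _ := by ring
    push_cast
    have e2 : (n : ℝ) * (n + 1 + 2) + 2 = (n + 1) * (n + 2) := by ring
    rw [e2]
    have e3 : 1 / (((n : ℝ) + 1) * (n + 2)) + 1 / (n + 2) = 1 / ((n + 1) * (n + 2)) * (n + 2) := by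
      field_simp
      ring
    rw [e3, pow_one]
    calc 2 * (1 / (((n : ℝ) + 1) * (n + 2)) * I) = 1 / ((n + 1) * (n + 2)) * (2 * I) := by ring
      _ < 1 / ((n + 1) * (n + 2)) * ((n + 2) * I') := by gcongr
      _ = _ := by ring
  · by_cases hnk : n = 3 ∧ k = 3
    · obtain ⟨rfl, rfl⟩ := hnk
      exact mixedMoment_three_three
    · refine lt_of_lt_of_le ?_ (sum_evenTerm_le_mixedMoment n k)
      simpa [evenTerm] using two_pow_mul_lt_sum_evenTerm hn hk hnk

/-- The weight `√(1 - x ^ 2) ^ p` with values in `ℝ≥0∞`. -/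
noncomputable def capWeight (p : ℕ) (x : ℝ) : ENNReal := ENNReal.ofReal (√(1 - x ^ 2) ^ p)

@[fun_prop]
lemma measurable_capWeight (p : ℕ) : Measurable (capWeight p) := by
  unfold capWeight; fun_prop

lemma capWeight_neg (p : ℕ) (x : ℝ) : capWeight p (-x) = capWeight p x := by
  simp [capWeight]

lemma capWeight_eq_zero {p : ℕ} (hp : p ≠ 0) {x : ℝ} (hx : 1 ≤ |x|) : capWeight p x = 0 := by
  have : 1 - x ^ 2 ≤ 0 := by
    rw [← sq_abs]; nlinarith
  simp [capWeight, Real.sqrt_eq_zero_of_nonpos this, hp]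

lemma lintegral_capWeight_mul {p : ℕ} (hp : p ≠ 0) {g : ℝ → ENNReal} (hg : Measurable g) :
    ∫⁻ x, capWeight p x * g x = ∫⁻ x in Set.Icc (0 : ℝ) 1, capWeight p x * (g x + g (-x)) := by
  have h1 : ∀ G : ℝ → ENNReal, ∫⁻ x in Set.Ioi (0 : ℝ), capWeight p x * G x
      = ∫⁻ x in Set.Icc (0 : ℝ) 1, capWeight p x * G x := by
    intro G
    rw [← restrict_Ioc_eq_restrict_Icc, ← lintegral_indicator measurableSet_Ioi,
      ← lintegral_indicator measurableSet_Ioc]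
    refine lintegral_congr fun x => ?_
    by_cases hx : x ∈ Set.Ioc (0 : ℝ) 1
    · rw [Set.indicator_of_mem hx, Set.indicator_of_mem (show x ∈ Set.Ioi (0 : ℝ) from hx.1)]
    · rw [Set.indicator_of_notMem hx]
      refine Set.indicator_apply_eq_zero.2 fun h0 => ?_
      have h1 : 1 ≤ |x| := by
        rw [abs_of_pos h0]
        by_contra! h
        exact hx ⟨h0, h.le⟩
      rw [capWeight_eq_zero hp h1, zero_mul]
  have h2 : ∫⁻ x in Set.Iic (0 : ℝ), capWeight p x * g x
      = ∫⁻ x in Set.Ioi (0 : ℝ), capWeight p x * g (-x) := by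
    rw [← restrict_Iio_eq_restrict_Iic]
    have := (Measure.measurePreserving_neg (volume : Measure ℝ)).setLIntegral_comp_preimage_emb
      (MeasurableEquiv.neg ℝ).measurableEmbedding (fun x => capWeight p x * g x) (Set.Iio 0)
    rw [← this]
    simp [capWeight_neg]
  rw [← lintegral_add_compl _ (measurableSet_Ioi (a := (0 : ℝ))), Set.compl_Ioi, h2, h1, h1,
    ← lintegral_add_left (by fun_prop)]
  simp only [mul_add]

lemma lintegral_capWeight_mul_pow {p : ℕ} (hp : p ≠ 0) (k : ℕ) :
    ∫⁻ x, capWeight p x * ENNReal.ofReal (|x| ^ k) = ENNReal.ofReal (2 * capMoment p k) := by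
  rw [lintegral_capWeight_mul hp (by fun_prop), capMoment,
    intervalIntegral.integral_of_le zero_le_one, ← integral_Icc_eq_integral_Ioc,
    ← integral_const_mul, ofReal_integral_eq_lintegral_ofReal]
  · refine setLIntegral_congr_fun measurableSet_Icc fun x hx => ?_
    simp only [capWeight, abs_neg, abs_of_nonneg hx.1]
    rw [← ENNReal.ofReal_add (by have := hx.1; positivity) (by have := hx.1; positivity),
      ← ENNReal.ofReal_mul (by positivity)]
    congr 1
    ring
  · exact (Continuous.continuousOn (by fun_prop)).integrableOn_compact isCompact_Icc
  · refine (ae_restrict_iff' measurableSet_Icc).2 (Filter.Eventually.of_forall fun x hx => ?_)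
    have := hx.1
    simp only [Pi.zero_apply]
    positivity

lemma lintegral_lintegral_capWeight {p n : ℕ} (hp : p ≠ 0) (hn : n ≠ 0) (k : ℕ) :
    ∫⁻ b, capWeight p b * ∫⁻ s, capWeight n s * ENNReal.ofReal (|b - s| ^ k)
      = ENNReal.ofReal (4 * mixedMoment k p n) := by
  have hm : Measurable fun b : ℝ => ∫⁻ s, capWeight n s * ENNReal.ofReal (|b - s| ^ k) :=
    Measurable.lintegral_prod_right' (f := fun z : ℝ × ℝ =>
      capWeight n z.2 * ENNReal.ofReal (|z.1 - z.2| ^ k)) (by fun_prop)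
  have h1 : ∀ b : ℝ, ∫⁻ s, capWeight n s * ENNReal.ofReal (|b - s| ^ k)
      = ∫⁻ s in Set.Icc (0 : ℝ) 1, ENNReal.ofReal ((|b + s| ^ k + |b - s| ^ k)
          * √(1 - s ^ 2) ^ n) := by
    intro b
    rw [lintegral_capWeight_mul hn (by fun_prop)]
    refine lintegral_congr fun s => ?_
    rw [sub_neg_eq_add, ← ENNReal.ofReal_add (by positivity) (by positivity), capWeight,
      ← ENNReal.ofReal_mul (by positivity)]
    congr 1
    ring
  rw [lintegral_capWeight_mul hp hm, mixedMoment, ← integral_const_mul,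
    ofReal_integral_eq_lintegral_ofReal (integrableOn_unitSquare (by fun_prop))
    (Filter.Eventually.of_forall fun z => by simp only [Pi.zero_apply]; positivity),
    Measure.volume_eq_prod, ← Measure.prod_restrict, lintegral_prod _ (by fun_prop)]
  refine lintegral_congr fun b => ?_
  rw [h1, h1, ← lintegral_add_left (by fun_prop), capWeight, ← lintegral_const_mul _ (by fun_prop)]
  refine lintegral_congr fun s => ?_
  rw [← ENNReal.ofReal_add (by positivity) (by positivity), ← ENNReal.ofReal_mul (by positivity)]
  congr 1
  rw [show -b + s = -(b - s) by ring, show -b - s = -(b + s) by ring, abs_neg, abs_neg]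
  ring

/-- The one-dimensional inequality behind the comparison of the two moments in the ball. -/
theorem two_pow_mul_lintegral_capWeight_lt {n k : ℕ} (hn : 3 ≤ n) (hk : 1 ≤ k) :
    2 ^ k * ((∫⁻ b, capWeight (n * (n + k + 2)) b * ENNReal.ofReal (|b| ^ k))
        * ∫⁻ s, capWeight n s)
      < ∫⁻ b, capWeight (n * (n + k + 2)) b *
          ∫⁻ s, capWeight n s * ENNReal.ofReal (|b - s| ^ k) := by
  have hn0 : n ≠ 0 := by omega
  have hp0 : n * (n + k + 2) ≠ 0 := by positivity
  have h0 := lintegral_capWeight_mul_pow hn0 0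
  simp only [pow_zero, ENNReal.ofReal_one, mul_one] at h0
  rw [lintegral_capWeight_mul_pow hp0, lintegral_lintegral_capWeight hp0 hn0, h0,
    show (2 : ENNReal) ^ k = ENNReal.ofReal (2 ^ k) by
      rw [ENNReal.ofReal_pow (by norm_num)]; norm_num,
    ← ENNReal.ofReal_mul (by have := capMoment_pos (n * (n + k + 2)) k; positivity),
    ← ENNReal.ofReal_mul (by positivity)]
  have h := two_pow_mul_capMoment_lt_mixedMoment hn hk
  have h' : 0 < 2 ^ k * (capMoment (n * (n + k + 2)) k * capMoment n 0) :=
    mul_pos (by positivity) (mul_pos (capMoment_pos _ _) (capMoment_pos _ _))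
  exact (ENNReal.ofReal_lt_ofReal_iff (by linarith)).2 (by linarith)

/-- The matrix whose rows are the points `y i` followed by a `1`. -/
def affineMatrix {R : Type*} [One R] {n : ℕ} (y : Fin (n + 1) → Fin n → R) :
    Matrix (Fin (n + 1)) (Fin (n + 1)) R :=
  Matrix.of fun i => Fin.snoc (α := fun _ => R) (y i) 1

/-- The determinant of the matrix whose rows are the points `y i` followed by `t i`. -/
def lastColDet {n : ℕ} (y : Fin (n + 1) → Fin n → ℝ) (t : Fin (n + 1) → ℝ) : ℝ :=
  (affineMatrix y).cramer t (Fin.last n)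

lemma lastColDet_eq_det {n : ℕ} (y : Fin (n + 1) → Fin n → ℝ) (t : Fin (n + 1) → ℝ) :
    lastColDet y t = (Matrix.of fun i => Fin.snoc (α := fun _ => ℝ) (y i) (t i)).det := by
  rw [lastColDet, Matrix.cramer_apply]
  congr 1
  ext i j
  refine Fin.lastCases ?_ (fun j => ?_) j
  · simp
  · simp [affineMatrix]

lemma affineMatrix_mulVec_snoc {n : ℕ} (y : Fin (n + 1) → Fin n → ℝ) (a : Fin n → ℝ) (b : ℝ) :
    (affineMatrix y).mulVec (Fin.snoc (α := fun _ => ℝ) a b) = fun i => y i ⬝ᵥ a + b := by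
  ext i
  simp [affineMatrix, Matrix.mulVec, dotProduct, Fin.sum_univ_castSucc]

lemma lastColDet_dotProduct_add {n : ℕ} (y : Fin (n + 1) → Fin n → ℝ) (a : Fin n → ℝ) (b : ℝ) :
    lastColDet y (fun i => y i ⬝ᵥ a + b) = b * (affineMatrix y).det := by
  rw [lastColDet, ← affineMatrix_mulVec_snoc, Matrix.cramer_eq_adjugate_mulVec,
    Matrix.mulVec_mulVec, Matrix.adjugate_mul, Matrix.smul_mulVec, Matrix.one_mulVec]
  simp [mul_comm]

lemma det_affineMatrix_smul_add {n : ℕ} (y : Fin (n + 1) → Fin n → ℝ) (σ : ℝ) (c : Fin n → ℝ) :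
    (affineMatrix fun i => c + σ • y i).det = σ ^ n * (affineMatrix y).det := by
  set C : Matrix (Fin (n + 1)) (Fin (n + 1)) ℝ := Matrix.of fun i => Fin.lastCases
    (Fin.snoc (α := fun _ => ℝ) c 1) (fun i => Pi.single i.castSucc σ) i with hC
  have h : (affineMatrix fun i => c + σ • y i) = affineMatrix y * C := by
    ext i j
    rw [Matrix.mul_apply, Fin.sum_univ_castSucc]
    refine Fin.lastCases ?_ (fun j => ?_) j
    · simp [affineMatrix, hC]
    · simp [affineMatrix, hC, Pi.single_apply]
      ring
  have hT : C.BlockTriangular OrderDual.toDual := by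
    intro i j hij
    have hij : i < j := hij
    have hi : i ≠ Fin.last n := (hij.trans_le (Fin.le_last j)).ne
    obtain ⟨i, rfl⟩ := Fin.exists_castSucc_eq.2 hi
    simp [hC, hij.ne']
  rw [h, Matrix.det_mul, Matrix.det_of_isLowerTriangular _ hT, Fin.prod_univ_castSucc]
  simp [hC, mul_comm]

lemma lastColDet_sub {n : ℕ} (y : Fin (n + 1) → Fin n → ℝ) (a y₀ : Fin n → ℝ) (b t₀ : ℝ) :
    lastColDet (fun i => y i - y₀) (fun i => y i ⬝ᵥ a + b - t₀)
      = (b - (t₀ - y₀ ⬝ᵥ a)) * (affineMatrix y).det := by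
  have h1 : (fun i => y i ⬝ᵥ a + b - t₀)
      = fun i => (y i - y₀) ⬝ᵥ a + (b - (t₀ - y₀ ⬝ᵥ a)) := by
    ext i
    rw [sub_dotProduct]
    ring
  have h2 := det_affineMatrix_smul_add y 1 (-y₀)
  simp only [one_smul, one_pow, one_mul, neg_add_eq_sub] at h2
  rw [h1, lastColDet_dotProduct_add (fun i => y i - y₀), h2]

@[fun_prop]
lemma continuous_det_affineMatrix {n : ℕ} :
    Continuous fun y : Fin (n + 1) → Fin n → ℝ => (affineMatrix y).det := by
  refine Continuous.matrix_det ?_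
  refine continuous_matrix fun i j => ?_
  refine Fin.lastCases ?_ (fun j => ?_) j
  · simpa [affineMatrix] using continuous_const
  · simp only [affineMatrix, Matrix.of_apply, Fin.snoc_castSucc]
    fun_prop

@[fun_prop]
lemma continuous_lastColDet {n : ℕ} :
    Continuous fun z : (Fin (n + 1) → Fin n → ℝ) × (Fin (n + 1) → ℝ) => lastColDet z.1 z.2 := by
  simp only [lastColDet_eq_det]
  refine Continuous.matrix_det ?_
  refine continuous_matrix fun i j => ?_
  refine Fin.lastCases ?_ (fun j => ?_) j
  · simp only [Matrix.of_apply, Fin.snoc_last]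
    fun_prop
  · simp only [Matrix.of_apply, Fin.snoc_castSucc]
    fun_prop

lemma exists_det_affineMatrix_ne_zero (n : ℕ) :
    ∃ z : Fin (n + 1) → Fin n → ℝ, (affineMatrix z).det ≠ 0 := by
  refine ⟨fun i j => if i = j.castSucc then 1 else 0, ?_⟩
  rw [Matrix.det_of_isUpperTriangular]
  · rw [Fin.prod_univ_castSucc]
    simp [affineMatrix]
  · intro i j (hij : j < i)
    obtain ⟨j, rfl⟩ := Fin.exists_castSucc_eq.2 (hij.trans_le (Fin.le_last i)).ne
    simp [affineMatrix, hij.ne']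

lemma countable_det_affineMatrix_add_smul_eq_zero {n : ℕ} {z : Fin (n + 1) → Fin n → ℝ}
    (hz : (affineMatrix z).det ≠ 0) (y : Fin (n + 1) → Fin n → ℝ) :
    {s : ℝ | (affineMatrix (y + s • z)).det = 0}.Countable := by
  set N : Matrix (Fin (n + 1)) (Fin (n + 1)) (Polynomial ℝ) :=
    affineMatrix fun i j => Polynomial.C (z i j) + Polynomial.X * Polynomial.C (y i j) with hN
  have hev : ∀ u, N.det.eval u = (affineMatrix (z + u • y)).det := by
    intro u
    rw [← Polynomial.coe_evalRingHom, RingHom.map_det]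
    congr 1
    ext i j
    refine Fin.lastCases ?_ (fun j => ?_) j
    · simp [hN, affineMatrix]
    · simp [hN, affineMatrix]
      ring
  have hne : N.det ≠ 0 := by
    intro h
    have := hev 0
    rw [h] at this
    simp at this
    exact hz this.symm
  have hfin : {u : ℝ | N.det.IsRoot u}.Finite := by
    convert N.det.roots.toFinset.finite_toSet using 1
    ext u
    simp [hne]
  refine ((hfin.countable.image fun u => u⁻¹).union (Set.countable_singleton 0)).mono ?_
  intro s hs
  by_cases h0 : s = 0
  · exact Or.inr h0
  refine Or.inl ⟨s⁻¹, ?_, inv_inv s⟩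
  have h1 := det_affineMatrix_smul_add (y + s • z) s⁻¹ 0
  rw [show (affineMatrix (y + s • z)).det = 0 from hs, mul_zero] at h1
  rw [Set.mem_ofPred_eq, Polynomial.IsRoot, hev, ← h1]
  congr 2
  ext i j
  simp
  field_simp
  ring

lemma ae_det_affineMatrix_ne_zero (n : ℕ) :
    ∀ᵐ y : Fin (n + 1) → Fin n → ℝ, (affineMatrix y).det ≠ 0 := by
  obtain ⟨z, hz⟩ := exists_det_affineMatrix_ne_zero n
  set S := {y : Fin (n + 1) → Fin n → ℝ | (affineMatrix y).det = 0} with hS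
  have hSm : MeasurableSet S := (isClosed_singleton.preimage
    (continuous_det_affineMatrix (n := n))).measurableSet
  have h1 : ∀ y, volume {s : ℝ | y + s • z ∈ S} = 0 := fun y =>
    (countable_det_affineMatrix_add_smul_eq_zero hz y).measure_zero _
  have hf : Measurable fun p : (Fin (n + 1) → Fin n → ℝ) × ℝ =>
      S.indicator (fun _ => (1 : ENNReal)) (p.1 + p.2 • z) :=
    (measurable_const.indicator hSm).comp (by fun_prop)
  have h2 : ∫⁻ y : Fin (n + 1) → Fin n → ℝ, ∫⁻ s : ℝ,
      S.indicator (fun _ => (1 : ENNReal)) (y + s • z) = 0 := by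
    have : ∀ y, ∫⁻ s : ℝ, S.indicator (fun _ => (1 : ENNReal)) (y + s • z) = 0 := by
      intro y
      have hm : MeasurableSet {s : ℝ | y + s • z ∈ S} :=
        hSm.preimage (f := fun s : ℝ => y + s • z) (by fun_prop)
      rw [← h1 y, ← lintegral_indicator_one hm]
      rfl
    simp [this]
  rw [lintegral_lintegral_swap hf.aemeasurable] at h2
  have h3 : ∀ s : ℝ, ∫⁻ y : Fin (n + 1) → Fin n → ℝ,
      S.indicator (fun _ => (1 : ENNReal)) (y + s • z) = volume S := by
    intro s
    rw [lintegral_add_right_eq_self, ← lintegral_indicator_one hSm]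
    rfl
  simp only [h3, lintegral_const, Real.volume_univ, mul_eq_zero, ENNReal.top_ne_zero,
    or_false] at h2
  rw [ae_iff]
  simpa using h2

lemma lintegral_comp_mulVec {ι : Type*} [Fintype ι] [DecidableEq ι] {M : Matrix ι ι ℝ}
    (hM : M.det ≠ 0) {F : (ι → ℝ) → ENNReal} (hF : Measurable F) :
    ∫⁻ t, F t = ENNReal.ofReal |M.det| * ∫⁻ v, F (M.mulVec v) := by
  have h := Real.map_matrix_volume_pi_eq_smul_volume_pi hM
  have hm : Measurable (Matrix.toLin' M) := (LinearMap.continuous_on_pi _).measurable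
  have h1 : ∫⁻ v, F (M.mulVec v) = ENNReal.ofReal |M.det|⁻¹ * ∫⁻ t, F t := by
    rw [← abs_inv, ← smul_eq_mul, ← lintegral_smul_measure, ← h, lintegral_map hF hm]
    rfl
  rw [h1, ← mul_assoc, ← ENNReal.ofReal_mul (abs_nonneg _), mul_inv_cancel₀ (abs_ne_zero.2 hM)]
  simp

lemma lintegral_fin_succ_eq_snoc {n : ℕ} {F : (Fin (n + 1) → ℝ) → ENNReal} (hF : Measurable F) :
    ∫⁻ v, F v = ∫⁻ c : (Fin n → ℝ) × ℝ, F (Fin.snoc (α := fun _ => ℝ) c.1 c.2) := by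
  have h := (volume_preserving_piFinSuccAbove (fun _ : Fin (n + 1) => ℝ) (Fin.last n)).symm
  have h' : ∀ (a : Fin n → ℝ) (b : ℝ),
      (MeasurableEquiv.piFinSuccAbove (fun _ : Fin (n + 1) => ℝ) (Fin.last n)).symm (b, a)
        = Fin.snoc (α := fun _ => ℝ) a b := by
    intro a b
    exact Fin.insertNth_last' b a
  rw [← h.lintegral_comp hF, Measure.volume_eq_prod, ← lintegral_prod_swap]
  refine lintegral_congr fun c => ?_
  rw [← h']
  rfl

@[fun_prop]
lemma Measurable.det_affineMatrix {α : Type*} [MeasurableSpace α] {n : ℕ}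
    {f : α → Fin (n + 1) → Fin n → ℝ} (hf : Measurable f) :
    Measurable fun x => (affineMatrix (f x)).det :=
  (continuous_det_affineMatrix (n := n)).measurable.comp hf

/-- An affine Blaschke-Petkantschin formula in graph coordinates: `n + 1` points of
`ℝ × ℝⁿ` are parametrised by the graph `t = ⟪a, y⟫ + b` through them. -/
lemma lintegral_eq_lintegral_graph {n : ℕ} {F : (Fin (n + 1) → ℝ × (Fin n → ℝ)) → ENNReal}
    (hF : Measurable F) :
    ∫⁻ z, F z = ∫⁻ a : Fin n → ℝ, ∫⁻ b : ℝ, ∫⁻ y : Fin (n + 1) → Fin n → ℝ,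
      ENNReal.ofReal |(affineMatrix y).det| * F fun i => (y i ⬝ᵥ a + b, y i) := by
  have h := (volume_measurePreserving_arrowProdEquivProdArrow ℝ (Fin n → ℝ) (Fin (n + 1))).symm
  have hF' := hF.comp (MeasurableEquiv.arrowProdEquivProdArrow ℝ (Fin n → ℝ)
    (Fin (n + 1))).symm.measurable
  have hdot : Measurable fun p : ((Fin n → ℝ) × ℝ) × (Fin (n + 1) → Fin n → ℝ) =>
      fun i => (p.2 i ⬝ᵥ p.1.1 + p.1.2, p.2 i) := by
    unfold dotProduct
    fun_prop
  have hG : Measurable fun p : ((Fin n → ℝ) × ℝ) × (Fin (n + 1) → Fin n → ℝ) =>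
      ENNReal.ofReal |(affineMatrix p.2).det| * F fun i => (p.2 i ⬝ᵥ p.1.1 + p.1.2, p.2 i) :=
    Measurable.mul (by fun_prop) (hF.comp hdot)
  rw [← h.lintegral_comp hF, Measure.volume_eq_prod, ← lintegral_prod_swap,
    lintegral_prod _ (by exact (hF'.comp measurable_swap).aemeasurable)]
  have h1 : ∀ᵐ y : Fin (n + 1) → Fin n → ℝ, ∫⁻ t : Fin (n + 1) → ℝ,
      F ((MeasurableEquiv.arrowProdEquivProdArrow ℝ (Fin n → ℝ) (Fin (n + 1))).symm
        (Prod.swap (y, t)))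
      = ∫⁻ c : (Fin n → ℝ) × ℝ,
        ENNReal.ofReal |(affineMatrix y).det| * F fun i => (y i ⬝ᵥ c.1 + c.2, y i) := by
    filter_upwards [ae_det_affineMatrix_ne_zero n] with y hy
    have hFy : Measurable fun t : Fin (n + 1) → ℝ =>
        F ((MeasurableEquiv.arrowProdEquivProdArrow ℝ (Fin n → ℝ) (Fin (n + 1))).symm
          (Prod.swap (y, t))) :=
      hF'.comp (by fun_prop)
    rw [lintegral_comp_mulVec hy hFy, lintegral_fin_succ_eq_snoc
      (by exact hFy.comp (LinearMap.continuous_on_pi (Matrix.toLin' (affineMatrix y))).measurable),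
      ← lintegral_const_mul']
    · refine lintegral_congr fun c => ?_
      rw [affineMatrix_mulVec_snoc]
      rfl
    · simp
  rw [lintegral_congr_ae h1, lintegral_lintegral_swap
    (by exact (hG.comp measurable_swap).aemeasurable), Measure.volume_eq_prod, lintegral_prod]
  exact (Measurable.lintegral_prod_right' hG).aemeasurable

lemma lintegral_eq_ofReal_pow_mul_lintegral_comp_smul {V : Type*} [NormedAddCommGroup V]
    [NormedSpace ℝ V] [MeasurableSpace V] [BorelSpace V] [FiniteDimensional ℝ V] (μ : Measure V)
    [μ.IsAddHaarMeasure] {σ : ℝ} (hσ : 0 < σ) (c : V) {f : V → ENNReal} (hf : Measurable f) :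
    ∫⁻ y, f y ∂μ = ENNReal.ofReal (σ ^ Module.finrank ℝ V) * ∫⁻ z, f (c + σ • z) ∂μ := by
  have hg : Measurable fun z => f (c + z) := hf.comp (measurable_const_add c)
  have h : ∫⁻ z, f (c + σ • z) ∂μ
      = ENNReal.ofReal (σ ^ Module.finrank ℝ V)⁻¹ * ∫⁻ z, f (c + z) ∂μ := by
    rw [← lintegral_map (f := fun z => f (c + z)) (g := fun z => σ • z) hg (by fun_prop),
      Measure.map_addHaar_smul μ hσ.ne', lintegral_smul_measure, smul_eq_mul,
      abs_of_pos (by positivity)]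
  rw [h, lintegral_add_left_eq_self, ← mul_assoc, ← ENNReal.ofReal_mul (by positivity),
    mul_inv_cancel₀ (by positivity)]
  simp

lemma setLIntegral_eq_of_homothety {V : Type*} [NormedAddCommGroup V]
    [NormedSpace ℝ V] [MeasurableSpace V] [BorelSpace V] [FiniteDimensional ℝ V] [Nontrivial V]
    (μ : Measure V) [μ.IsAddHaarMeasure] {σ : ℝ} (hσ : 0 ≤ σ) (c : V) (e : ℕ) {E E' : Set V}
    (hE : MeasurableSet E) (hE' : MeasurableSet E') {G : V → ENNReal} (hG : Measurable G)
    (hmem : 0 < σ → ∀ z, c + σ • z ∈ E' ↔ z ∈ E) (hsub : σ = 0 → E' ⊆ {c})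
    (hhom : 0 < σ → ∀ z, G (c + σ • z) = ENNReal.ofReal (σ ^ e) * G z) :
    ∫⁻ y in E', G y ∂μ
      = ENNReal.ofReal (σ ^ (Module.finrank ℝ V + e)) * ∫⁻ z in E, G z ∂μ := by
  have hd : 0 < Module.finrank ℝ V := Module.finrank_pos
  rcases hσ.eq_or_lt with h0 | h0
  · have : μ E' = 0 := measure_mono_null (hsub h0.symm) (measure_singleton c)
    rw [setLIntegral_measure_zero _ _ this, ← h0, zero_pow (by omega)]
    simp
  · rw [← lintegral_indicator hE', ← lintegral_indicator hE,
      lintegral_eq_ofReal_pow_mul_lintegral_comp_smul μ h0 c (hG.indicator hE'), pow_add,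
      ENNReal.ofReal_mul (by positivity), mul_assoc,
      ← lintegral_const_mul' (ENNReal.ofReal (σ ^ e)) _ (by simp)]
    congr 1
    refine lintegral_congr fun z => ?_
    by_cases hz : z ∈ E
    · rw [Set.indicator_of_mem hz, Set.indicator_of_mem ((hmem h0 z).2 hz), hhom h0]
    · rw [Set.indicator_of_notMem hz, Set.indicator_of_notMem (fun h => hz ((hmem h0 z).1 h)),
        mul_zero]

/-- The closed unit ball of `ℝ × ℝⁿ` with its Euclidean structure. -/
def graphBall (n : ℕ) : Set (ℝ × (Fin n → ℝ)) := {x | x.1 ^ 2 + x.2 ⬝ᵥ x.2 ≤ 1}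

/-- The section of the unit ball by the graph of `y ↦ y ⬝ᵥ a + b`, projected to `ℝⁿ`. -/
def graphSection {n : ℕ} (a : Fin n → ℝ) (b : ℝ) : Set (Fin n → ℝ) :=
  {y | (y ⬝ᵥ a + b) ^ 2 + y ⬝ᵥ y ≤ 1}

/-- The factor by which lengths along the normal of the graph of `y ↦ y ⬝ᵥ a` are scaled. -/
noncomputable def graphSlope {n : ℕ} (a : Fin n → ℝ) : ℝ := √(1 + a ⬝ᵥ a)

@[fun_prop]
lemma Continuous.dotProduct_real {α : Type*} [TopologicalSpace α] {n : ℕ} {f g : α → Fin n → ℝ}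
    (hf : Continuous f) (hg : Continuous g) : Continuous fun x => f x ⬝ᵥ g x := by
  unfold dotProduct
  fun_prop

@[fun_prop]
lemma Measurable.dotProduct_real {α : Type*} [MeasurableSpace α] {n : ℕ} {f g : α → Fin n → ℝ}
    (hf : Measurable f) (hg : Measurable g) : Measurable fun x => f x ⬝ᵥ g x := by
  unfold dotProduct
  fun_prop

lemma isClosed_graphBall (n : ℕ) : IsClosed (graphBall n) :=
  isClosed_le (by fun_prop) continuous_const

lemma isClosed_graphSection {n : ℕ} (a : Fin n → ℝ) (b : ℝ) : IsClosed (graphSection a b) :=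
  isClosed_le (by fun_prop) continuous_const

lemma dotProduct_self_nonneg_real {n : ℕ} (a : Fin n → ℝ) : 0 ≤ a ⬝ᵥ a :=
  Finset.sum_nonneg fun i _ => mul_self_nonneg (a i)

lemma graphSlope_pos {n : ℕ} (a : Fin n → ℝ) : 0 < graphSlope a :=
  Real.sqrt_pos.2 (by have := dotProduct_self_nonneg_real a; linarith)

lemma graphSlope_sq {n : ℕ} (a : Fin n → ℝ) : graphSlope a ^ 2 = 1 + a ⬝ᵥ a :=
  Real.sq_sqrt (by have := dotProduct_self_nonneg_real a; linarith)

lemma graphSection_quadratic {n : ℕ} (a z : Fin n → ℝ) (b σ : ℝ) :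
    ((-(b / graphSlope a ^ 2) • a + σ • z) ⬝ᵥ a + b) ^ 2
      + (-(b / graphSlope a ^ 2) • a + σ • z) ⬝ᵥ (-(b / graphSlope a ^ 2) • a + σ • z)
      = σ ^ 2 * ((z ⬝ᵥ a) ^ 2 + z ⬝ᵥ z) + (b / graphSlope a) ^ 2 := by
  have h := graphSlope_sq a
  have h0 := (graphSlope_pos a).ne'
  have hA : a ⬝ᵥ a = graphSlope a ^ 2 - 1 := by linarith
  simp only [add_dotProduct, dotProduct_add, smul_dotProduct, dotProduct_smul, smul_eq_mul, hA,
    dotProduct_comm a z]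
  field_simp
  ring

lemma mem_graphSection_homothety {n : ℕ} (a z : Fin n → ℝ) (b : ℝ)
    (h : 0 < √(1 - (b / graphSlope a) ^ 2)) :
    -(b / graphSlope a ^ 2) • a + √(1 - (b / graphSlope a) ^ 2) • z ∈ graphSection a b
      ↔ z ∈ graphSection a 0 := by
  simp only [graphSection, Set.mem_ofPred_eq]
  have h1 := Real.sqrt_pos.1 h
  rw [graphSection_quadratic, Real.sq_sqrt h1.le, add_zero]
  constructor
  · intro h2
    by_contra! h3
    nlinarith
  · intro h2
    nlinarith

lemma graphSection_subset_singleton {n : ℕ} (a : Fin n → ℝ) (b : ℝ)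
    (h : √(1 - (b / graphSlope a) ^ 2) = 0) :
    graphSection a b ⊆ {-(b / graphSlope a ^ 2) • a} := by
  intro y hy
  have h1 := Real.sqrt_eq_zero'.1 h
  have h2 := graphSection_quadratic a (y + (b / graphSlope a ^ 2) • a) b 1
  rw [one_smul, show -(b / graphSlope a ^ 2) • a + (y + (b / graphSlope a ^ 2) • a) = y by
    rw [neg_smul]; abel] at h2
  have hy : (y ⬝ᵥ a + b) ^ 2 + y ⬝ᵥ y ≤ 1 := hy
  have h3 := dotProduct_self_nonneg_real (y + (b / graphSlope a ^ 2) • a)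
  have h4 : (y + (b / graphSlope a ^ 2) • a) ⬝ᵥ (y + (b / graphSlope a ^ 2) • a) = 0 := by
    nlinarith [sq_nonneg ((y + (b / graphSlope a ^ 2) • a) ⬝ᵥ a)]
  have h5 := dotProduct_self_eq_zero.1 h4
  rw [Set.mem_singleton_iff, neg_smul]
  exact eq_neg_of_add_eq_zero_left h5

lemma volume_graphSection {n : ℕ} (hn : n ≠ 0) (a : Fin n → ℝ) (b : ℝ) :
    volume (graphSection a b) = capWeight n (b / graphSlope a) * volume (graphSection a 0) := by
  have : NeZero n := ⟨hn⟩
  have h := setLIntegral_eq_of_homothety (volume : Measure (Fin n → ℝ)) (Real.sqrt_nonneg _)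
    (-(b / graphSlope a ^ 2) • a) 0 (isClosed_graphSection a 0).measurableSet
    (isClosed_graphSection a b).measurableSet (G := fun _ => 1) measurable_const
    (fun h z => mem_graphSection_homothety a z b h) (graphSection_subset_singleton a b) (by simp)
  simpa [capWeight] using h

/-- The moments of the simplex determinant in a central section of the unit ball. -/
noncomputable def sectionMoment {n : ℕ} (k : ℕ) (a : Fin n → ℝ) : ENNReal :=
  ∫⁻ y in Set.univ.pi fun _ : Fin (n + 1) => graphSection a 0,
    ENNReal.ofReal |(affineMatrix y).det| ^ k

lemma lintegral_graphSection_det {n : ℕ} (hn : n ≠ 0) (k : ℕ) (a : Fin n → ℝ) (b : ℝ) :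
    ∫⁻ y in Set.univ.pi fun _ : Fin (n + 1) => graphSection a b,
      ENNReal.ofReal |(affineMatrix y).det| ^ k
    = capWeight (n * (n + k + 1)) (b / graphSlope a) * sectionMoment k a := by
  have : NeZero n := ⟨hn⟩
  have hm : ∀ b, MeasurableSet (Set.univ.pi fun _ : Fin (n + 1) => graphSection a b) := fun b =>
    MeasurableSet.univ_pi fun _ => (isClosed_graphSection a b).measurableSet
  have h := setLIntegral_eq_of_homothety (volume : Measure (Fin (n + 1) → Fin n → ℝ))
    (Real.sqrt_nonneg (1 - (b / graphSlope a) ^ 2))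
    (fun _ => -(b / graphSlope a ^ 2) • a) (n * k) (hm 0) (hm b)
    (G := fun y => ENNReal.ofReal |(affineMatrix y).det| ^ k) (by fun_prop)
    (fun h z => ?_) (fun h y hy => ?_) (fun h z => ?_)
  · rw [h, sectionMoment, capWeight]
    congr 3
    rw [Module.finrank_pi_fintype]
    simp
    ring
  · rw [Set.mem_univ_pi, Set.mem_univ_pi]
    exact forall_congr' fun i => mem_graphSection_homothety a (z i) b h
  · rw [Set.mem_univ_pi] at hy
    exact funext fun i => graphSection_subset_singleton a b h (hy i)
  · have h1 := det_affineMatrix_smul_add z (√(1 - (b / graphSlope a) ^ 2))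
      (-(b / graphSlope a ^ 2) • a)
    rw [show ((fun _ => -(b / graphSlope a ^ 2) • a) + √(1 - (b / graphSlope a) ^ 2) • z)
      = fun i => -(b / graphSlope a ^ 2) • a + √(1 - (b / graphSlope a) ^ 2) • z i from rfl, h1,
      abs_mul, ENNReal.ofReal_mul (abs_nonneg _), mul_pow, ← ENNReal.ofReal_pow (abs_nonneg _),
      abs_of_pos (by positivity), ← pow_mul]

lemma measurableSet_graphBall (n : ℕ) : MeasurableSet (graphBall n) :=
  (isClosed_graphBall n).measurableSet

lemma isCompact_graphBall (n : ℕ) : IsCompact (graphBall n) := by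
  refine Metric.isCompact_of_isClosed_isBounded (isClosed_graphBall n)
    ((Metric.isBounded_closedBall (x := (0 : ℝ × (Fin n → ℝ))) (r := 1)).subset ?_)
  intro x hx
  have hx : x.1 ^ 2 + x.2 ⬝ᵥ x.2 ≤ 1 := hx
  rw [mem_closedBall_zero_iff, Prod.norm_def, max_le_iff, pi_norm_le_iff_of_nonneg zero_le_one]
  constructor
  · rw [Real.norm_eq_abs, abs_le_one_iff_mul_self_le_one]
    nlinarith [dotProduct_self_nonneg_real x.2]
  · intro i
    rw [Real.norm_eq_abs, abs_le_one_iff_mul_self_le_one]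
    have : x.2 i * x.2 i ≤ x.2 ⬝ᵥ x.2 :=
      Finset.single_le_sum (f := fun i => x.2 i * x.2 i) (fun i _ => mul_self_nonneg (x.2 i))
        (Finset.mem_univ i)
    nlinarith [sq_nonneg x.1]

lemma setLIntegral_graphBall {n : ℕ} (hn : n ≠ 0) (a : Fin n → ℝ) {g : ℝ → ENNReal}
    (hg : Measurable g) :
    ∫⁻ x in graphBall n, g (x.1 - x.2 ⬝ᵥ a)
      = volume (graphSection a 0) * ∫⁻ s, capWeight n (s / graphSlope a) * g s := by
  have hm : Measurable fun p : (Fin n → ℝ) × ℝ =>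
      (graphBall n).indicator (fun x => g (x.1 - x.2 ⬝ᵥ a)) (p.2, p.1) :=
    ((hg.comp (by fun_prop)).indicator (measurableSet_graphBall n)).comp (by fun_prop)
  have hm' : Measurable fun p : (Fin n → ℝ) × ℝ =>
      (graphBall n).indicator (fun x => g (x.1 - x.2 ⬝ᵥ a)) (p.2 + p.1 ⬝ᵥ a, p.1) :=
    ((hg.comp (by fun_prop)).indicator (measurableSet_graphBall n)).comp (by fun_prop)
  rw [← lintegral_indicator (measurableSet_graphBall n), Measure.volume_eq_prod,
    ← lintegral_prod_swap, lintegral_prod _ (by exact hm.aemeasurable)]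
  have h1 : ∀ y : Fin n → ℝ, ∫⁻ t : ℝ,
      (graphBall n).indicator (fun x => g (x.1 - x.2 ⬝ᵥ a)) (Prod.swap (y, t))
      = ∫⁻ s : ℝ,
        (graphBall n).indicator (fun x => g (x.1 - x.2 ⬝ᵥ a)) (s + y ⬝ᵥ a, y) := by
    intro y
    exact (lintegral_add_right_eq_self (μ := volume) (fun t : ℝ =>
      (graphBall n).indicator (fun x => g (x.1 - x.2 ⬝ᵥ a)) (t, y)) (y ⬝ᵥ a)).symm
  simp only [h1]
  rw [lintegral_lintegral_swap (by exact hm'.aemeasurable),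
    ← lintegral_const_mul _ (by fun_prop)]
  refine lintegral_congr fun s => ?_
  rw [← mul_assoc, mul_comm (volume _), ← volume_graphSection hn, mul_comm,
    ← setLIntegral_const, ← lintegral_indicator (isClosed_graphSection a s).measurableSet]
  refine lintegral_congr fun y => ?_
  have : (s + y ⬝ᵥ a, y) ∈ graphBall n ↔ y ∈ graphSection a s := by
    simp [graphBall, graphSection, add_comm s]
  by_cases hy : y ∈ graphSection a s
  · rw [Set.indicator_of_mem hy, Set.indicator_of_mem (this.2 hy)]
    simp
  · rw [Set.indicator_of_notMem hy, Set.indicator_of_notMem (fun h => hy (this.1 h))]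

lemma lintegral_pi_graphBall {n k : ℕ} (hn : n ≠ 0)
    {F : (Fin (n + 1) → ℝ × (Fin n → ℝ)) → ENNReal} (hF : Measurable F)
    {h : (Fin n → ℝ) → ℝ → ENNReal} (hh : ∀ a, Measurable (h a))
    (hFh : ∀ a b y, F (fun i => (y i ⬝ᵥ a + b, y i))
      = ENNReal.ofReal |(affineMatrix y).det| ^ k * h a b) :
    ∫⁻ z, F z ∂Measure.pi (fun _ => volume.restrict (graphBall n))
      = ∫⁻ a, sectionMoment (k + 1) a *
          ∫⁻ b, capWeight (n * (n + k + 2)) (b / graphSlope a) * h a b := by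
  have hS : MeasurableSet (Set.univ.pi fun _ : Fin (n + 1) => graphBall n) :=
    MeasurableSet.univ_pi fun _ => measurableSet_graphBall n
  rw [← Measure.restrict_pi_pi, ← volume_pi, ← lintegral_indicator hS,
    lintegral_eq_lintegral_graph (hF.indicator hS)]
  refine lintegral_congr fun a => ?_
  have hha := hh a
  rw [← lintegral_const_mul _ (by fun_prop)]
  refine lintegral_congr fun b => ?_
  have hSb : MeasurableSet (Set.univ.pi fun _ : Fin (n + 1) => graphSection a b) :=
    MeasurableSet.univ_pi fun _ => (isClosed_graphSection a b).measurableSet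
  rw [show n * (n + k + 2) = n * (n + (k + 1) + 1) by ring, ← mul_assoc,
    mul_comm (sectionMoment _ _), ← lintegral_graphSection_det hn,
    ← lintegral_mul_const _ (by fun_prop), ← lintegral_indicator hSb]
  refine lintegral_congr fun y => ?_
  have : (fun i => (y i ⬝ᵥ a + b, y i)) ∈ (Set.univ.pi fun _ : Fin (n + 1) => graphBall n)
      ↔ y ∈ Set.univ.pi fun _ : Fin (n + 1) => graphSection a b := by
    simp [graphBall, graphSection]
  by_cases hy : y ∈ Set.univ.pi fun _ : Fin (n + 1) => graphSection a b
  · rw [Set.indicator_of_mem hy, Set.indicator_of_mem (this.2 hy), hFh]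
    ring
  · rw [Set.indicator_of_notMem hy, Set.indicator_of_notMem (fun h => hy (this.1 h)), mul_zero]

lemma volume_graphSection_zero_pos {n : ℕ} (a : Fin n → ℝ) : 0 < volume (graphSection a 0) := by
  have ho : IsOpen {y : Fin n → ℝ | (y ⬝ᵥ a + 0) ^ 2 + y ⬝ᵥ y < 1} :=
    isOpen_lt (by fun_prop) continuous_const
  refine (ho.measure_pos volume ⟨0, by simp⟩).trans_le (measure_mono fun y hy => ?_)
  have hy : (y ⬝ᵥ a + 0) ^ 2 + y ⬝ᵥ y < 1 := hy
  exact hy.le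

lemma sectionMoment_ne_zero {n : ℕ} (k : ℕ) (a : Fin n → ℝ) : sectionMoment k a ≠ 0 := by
  intro h
  rw [sectionMoment, lintegral_eq_zero_iff (by fun_prop)] at h
  have h1 : ∀ᵐ y : Fin (n + 1) → Fin n → ℝ
      ∂volume.restrict (Set.univ.pi fun _ => graphSection a 0), False := by
    filter_upwards [h, ae_restrict_of_ae (ae_det_affineMatrix_ne_zero n)] with y hy hy'
    simp only [Pi.zero_apply, pow_eq_zero_iff', ENNReal.ofReal_eq_zero, abs_nonpos_iff] at hy
    exact hy' hy.1
  rw [Filter.eventually_false_iff_eq_bot, ae_eq_bot, Measure.restrict_eq_zero, volume_pi_pi,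
    Finset.prod_eq_zero_iff] at h1
  obtain ⟨i, -, hi⟩ := h1
  exact (volume_graphSection_zero_pos a).ne' hi

lemma measurable_sectionMoment {n : ℕ} (k : ℕ) :
    Measurable (sectionMoment k : (Fin n → ℝ) → ENNReal) := by
  have hS : MeasurableSet {p : (Fin n → ℝ) × (Fin (n + 1) → Fin n → ℝ) |
      ∀ i, (p.2 i ⬝ᵥ p.1 + 0) ^ 2 + p.2 i ⬝ᵥ p.2 i ≤ 1} := by
    rw [Set.ofPred_forall]
    exact MeasurableSet.iInter fun i => measurableSet_le (by fun_prop) measurable_const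
  have h := Measurable.lintegral_prod_right' (ν := (volume : Measure (Fin (n + 1) → Fin n → ℝ)))
    (Measurable.indicator (f := fun p : (Fin n → ℝ) × (Fin (n + 1) → Fin n → ℝ) =>
      ENNReal.ofReal |(affineMatrix p.2).det| ^ k) (by fun_prop) hS)
  convert h using 2 with a
  rw [sectionMoment, ← lintegral_indicator (MeasurableSet.univ_pi fun _ =>
    (isClosed_graphSection a 0).measurableSet)]
  refine lintegral_congr fun y => ?_
  have hiff : y ∈ (Set.univ.pi fun _ : Fin (n + 1) => graphSection a 0)
      ↔ (a, y) ∈ {p : (Fin n → ℝ) × (Fin (n + 1) → Fin n → ℝ) |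
        ∀ i, (p.2 i ⬝ᵥ p.1 + 0) ^ 2 + p.2 i ⬝ᵥ p.2 i ≤ 1} := by
    simp [graphSection]
  by_cases hy : y ∈ Set.univ.pi fun _ : Fin (n + 1) => graphSection a 0
  · rw [Set.indicator_of_mem hy, Set.indicator_of_mem (hiff.1 hy)]
  · rw [Set.indicator_of_notMem hy, Set.indicator_of_notMem (fun h => hy (hiff.2 h))]

/-- The `k`-th moment of the determinant of `n + 1` points of `ℝ × ℝⁿ` with distribution `ν`. -/
noncomputable def originMoment {n : ℕ} (k : ℕ) (ν : Measure (ℝ × (Fin n → ℝ))) : ENNReal :=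
  ∫⁻ z, ENNReal.ofReal |lastColDet (fun i => (z i).2) (fun i => (z i).1)| ^ k
    ∂Measure.pi (fun _ : Fin (n + 1) => ν)

/-- The `k`-th moment of the determinant of the differences from a base point of `n + 1` points
of `ℝ × ℝⁿ`, where all points have distribution `ν`. -/
noncomputable def simplexMoment {n : ℕ} (k : ℕ) (ν : Measure (ℝ × (Fin n → ℝ))) : ENNReal :=
  ∫⁻ z, ∫⁻ x, ENNReal.ofReal
    |lastColDet (fun i => (z i).2 - x.2) (fun i => (z i).1 - x.1)| ^ k
    ∂ν ∂Measure.pi (fun _ : Fin (n + 1) => ν)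

@[fun_prop]
lemma measurable_lastColDet {n : ℕ} :
    Measurable fun z : (Fin (n + 1) → Fin n → ℝ) × (Fin (n + 1) → ℝ) => lastColDet z.1 z.2 :=
  continuous_lastColDet.measurable

@[fun_prop]
lemma Continuous.lastColDet {α : Type*} [TopologicalSpace α] {n : ℕ}
    {f : α → Fin (n + 1) → Fin n → ℝ} {g : α → Fin (n + 1) → ℝ} (hf : Continuous f)
    (hg : Continuous g) : Continuous fun x => _root_.lastColDet (f x) (g x) :=
  (continuous_lastColDet (n := n)).comp (hf.prodMk hg)

lemma lintegral_comp_div {ρ : ℝ} (hρ : 0 < ρ) {f : ℝ → ENNReal} (hf : Measurable f) :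
    ∫⁻ b, f b = ENNReal.ofReal ρ * ∫⁻ b, f (ρ * b) := by
  have h := lintegral_eq_ofReal_pow_mul_lintegral_comp_smul (volume : Measure ℝ) hρ 0 hf
  simpa using h

lemma lintegral_capWeight_div_mul {p k : ℕ} {ρ : ℝ} (hρ : 0 < ρ) (c : ℝ) :
    ∫⁻ b, capWeight p (b / ρ) * ENNReal.ofReal |ρ * c - b| ^ k
      = ENNReal.ofReal ρ ^ (k + 1) * ∫⁻ b, capWeight p b * ENNReal.ofReal (|c - b| ^ k) := by
  rw [lintegral_comp_div hρ (by fun_prop), pow_succ', mul_assoc]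
  congr 1
  rw [← lintegral_const_mul' _ _ (by simp)]
  refine lintegral_congr fun b => ?_
  rw [mul_div_cancel_left₀ _ hρ.ne', ← mul_sub, abs_mul, abs_of_pos hρ, ENNReal.ofReal_mul hρ.le,
    mul_pow, ENNReal.ofReal_pow (abs_nonneg _)]
  ring

lemma volume_graphBall {n : ℕ} (hn : n ≠ 0) (a : Fin n → ℝ) :
    volume (graphBall n) = volume (graphSection a 0) *
      (ENNReal.ofReal (graphSlope a) * ∫⁻ s, capWeight n s) := by
  have h := setLIntegral_graphBall hn a (g := fun _ => 1) measurable_const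
  have h2 := lintegral_capWeight_div_mul (p := n) (k := 0) (graphSlope_pos a) 0
  simp only [pow_zero, mul_one, zero_add, pow_one, ENNReal.ofReal_one] at h2
  simpa [h2] using h

lemma lintegral_capWeight_ne_zero {n : ℕ} (hn : n ≠ 0) : ∫⁻ s, capWeight n s ≠ 0 := by
  have h0 := lintegral_capWeight_mul_pow hn 0
  simp only [pow_zero, ENNReal.ofReal_one, mul_one] at h0
  rw [h0]
  have := capMoment_pos n 0
  simpa using this

lemma lintegral_capWeight_ne_top {n : ℕ} (hn : n ≠ 0) : ∫⁻ s, capWeight n s ≠ ⊤ := by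
  have h0 := lintegral_capWeight_mul_pow hn 0
  simp only [pow_zero, ENNReal.ofReal_one, mul_one] at h0
  rw [h0]
  exact ENNReal.ofReal_ne_top

lemma originMoment_graphBall {n : ℕ} (hn : n ≠ 0) (k : ℕ) :
    originMoment k (volume.restrict (graphBall n))
      = ∫⁻ a : Fin n → ℝ, sectionMoment (k + 1) a * (ENNReal.ofReal (graphSlope a) ^ (k + 1) *
          ∫⁻ b, capWeight (n * (n + k + 2)) b * ENNReal.ofReal (|b| ^ k)) := by
  rw [originMoment, lintegral_pi_graphBall hn (k := k) (h := fun _ b => ENNReal.ofReal |b| ^ k)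
    (by fun_prop) (fun _ => by fun_prop)]
  · refine lintegral_congr fun a => ?_
    have h := lintegral_capWeight_div_mul (p := n * (n + k + 2)) (k := k) (graphSlope_pos a) 0
    simp only [mul_zero, zero_sub, abs_neg] at h
    rw [h]
  · intro a b y
    rw [lastColDet_dotProduct_add, abs_mul, ENNReal.ofReal_mul (abs_nonneg _), mul_pow, mul_comm]

lemma simplexMoment_graphBall {n : ℕ} (hn : n ≠ 0) (k : ℕ) :
    simplexMoment k (volume.restrict (graphBall n))
      = ∫⁻ a : Fin n → ℝ, sectionMoment (k + 1) a * (volume (graphSection a 0) *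
          (ENNReal.ofReal (graphSlope a) ^ (k + 2) * ∫⁻ b, capWeight (n * (n + k + 2)) b *
            ∫⁻ s, capWeight n s * ENNReal.ofReal (|b - s| ^ k))) := by
  have hm1 : ∀ a : Fin n → ℝ, Measurable fun b : ℝ =>
      ∫⁻ s, capWeight n (s / graphSlope a) * ENNReal.ofReal |b - s| ^ k := fun a =>
    Measurable.lintegral_prod_right' (f := fun z : ℝ × ℝ =>
      capWeight n (z.2 / graphSlope a) * ENNReal.ofReal |z.1 - z.2| ^ k) (by fun_prop)
  rw [simplexMoment, lintegral_pi_graphBall hn (k := k) (h := fun a b =>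
    volume (graphSection a 0) *
      ∫⁻ s, capWeight n (s / graphSlope a) * ENNReal.ofReal |b - s| ^ k)]
  · refine lintegral_congr fun a => ?_
    congr 1
    have hρ := graphSlope_pos a
    have hm := hm1 a
    have hq : volume (graphSection a 0) ≠ ⊤ := by
      intro h
      have := volume_graphBall hn a
      rw [h, ENNReal.top_mul] at this
      · exact (isCompact_graphBall n).measure_lt_top.ne this
      · exact mul_ne_zero (ENNReal.ofReal_pos.2 hρ).ne' (lintegral_capWeight_ne_zero hn)
    simp only [mul_left_comm _ (volume (graphSection a 0))]
    rw [lintegral_const_mul' _ _ hq]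
    congr 1
    rw [lintegral_comp_div hρ (by fun_prop)]
    simp only [lintegral_capWeight_div_mul hρ, mul_div_cancel_left₀ _ hρ.ne',
      mul_left_comm (capWeight _ _)]
    rw [lintegral_const_mul' _ _ (by simp), ← mul_assoc, ← pow_succ']
  · exact Measurable.lintegral_prod_right' (f := fun p : (Fin (n + 1) → ℝ × (Fin n → ℝ)) × 
      (ℝ × (Fin n → ℝ)) => ENNReal.ofReal
      |lastColDet (fun i => (p.1 i).2 - p.2.2) (fun i => (p.1 i).1 - p.2.1)| ^ k) (by fun_prop)
  · exact fun a => (hm1 a).const_mul _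
  · intro a b y
    rw [← setLIntegral_graphBall hn a (g := fun s => ENNReal.ofReal |b - s| ^ k) (by fun_prop),
      ← lintegral_const_mul' _ _ (by simp)]
    refine lintegral_congr fun x => ?_
    rw [lastColDet_sub, abs_mul, ENNReal.ofReal_mul (abs_nonneg _), mul_pow, mul_comm]

lemma originMoment_restrict_ne_top {n : ℕ} (k : ℕ) {S : Set (ℝ × (Fin n → ℝ))}
    (hS : IsCompact S) : originMoment k (volume.restrict S) ≠ ⊤ := by
  rw [originMoment, ← Measure.restrict_pi_pi]
  have hc : IsCompact (Set.univ.pi fun _ : Fin (n + 1) => S) := isCompact_univ_pi fun _ => hS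
  have := (ContinuousOn.integrableOn_compact (f := fun z : Fin (n + 1) → ℝ × (Fin n → ℝ) =>
    |lastColDet (fun i => (z i).2) (fun i => (z i).1)| ^ k) (μ := volume) hc
    (Continuous.continuousOn (by fun_prop))).lintegral_lt_top
  simp only [ENNReal.ofReal_pow (abs_nonneg _)] at this
  exact this.ne

lemma two_pow_mul_originMoment_graphBall_lt {n k : ℕ} (hn : 3 ≤ n) (hk : 1 ≤ k) :
    2 ^ k * (volume (graphBall n) * originMoment k (volume.restrict (graphBall n)))
      < simplexMoment k (volume.restrict (graphBall n)) := by
  have hn0 : n ≠ 0 := by omega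
  have hp0 : n * (n + k + 2) ≠ 0 := by positivity
  have hlt := two_pow_mul_lintegral_capWeight_lt hn hk
  have hx0 : ∫⁻ b, capWeight (n * (n + k + 2)) b * ENNReal.ofReal (|b| ^ k) ≠ 0 := by
    rw [lintegral_capWeight_mul_pow hp0]
    simpa using capMoment_pos (n * (n + k + 2)) k
  have hxt : ∫⁻ b, capWeight (n * (n + k + 2)) b * ENNReal.ofReal (|b| ^ k) ≠ ⊤ := by
    rw [lintegral_capWeight_mul_pow hp0]
    exact ENNReal.ofReal_ne_top
  have hyt : ∫⁻ b, capWeight (n * (n + k + 2)) b *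
      ∫⁻ s, capWeight n s * ENNReal.ofReal (|b - s| ^ k) ≠ ⊤ := by
    rw [lintegral_lintegral_capWeight hp0 hn0]
    exact ENNReal.ofReal_ne_top
  have hw0 := lintegral_capWeight_ne_zero hn0
  have hwt := lintegral_capWeight_ne_top hn0
  have hO := originMoment_graphBall hn0 k
  have hS := simplexMoment_graphBall hn0 k
  have hOt := originMoment_restrict_ne_top k (isCompact_graphBall n)
  have hBt : volume (graphBall n) ≠ ⊤ := (isCompact_graphBall n).measure_lt_top.ne
  have hB := volume_graphBall hn0
  generalize (∫⁻ b, capWeight (n * (n + k + 2)) b * ENNReal.ofReal (|b| ^ k)) = x at *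
  generalize (∫⁻ b, capWeight (n * (n + k + 2)) b *
      ∫⁻ s, capWeight n s * ENNReal.ofReal (|b - s| ^ k)) = y at *
  generalize (∫⁻ s, capWeight n s) = w at *
  have hB0 : volume (graphBall n) ≠ 0 := by
    rw [hB 0]
    have := (volume_graphSection_zero_pos (0 : Fin n → ℝ)).ne'
    have := (ENNReal.ofReal_pos.2 (graphSlope_pos (0 : Fin n → ℝ))).ne'
    positivity
  simp only [← mul_assoc] at hO
  rw [lintegral_mul_const' _ _ hxt] at hO
  set D := ∫⁻ a : Fin n → ℝ, sectionMoment (k + 1) a * ENNReal.ofReal (graphSlope a) ^ (k + 1)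
    with hD
  have hD0 : D ≠ 0 := by
    rw [hD, Ne, lintegral_eq_zero_iff' ]
    · intro h
      obtain ⟨a, ha⟩ := h.exists
      simp only [Pi.zero_apply, mul_eq_zero, sectionMoment_ne_zero, false_or, pow_eq_zero_iff',
        ENNReal.ofReal_eq_zero, (graphSlope_pos a).not_ge, false_and] at ha
    · refine (Measurable.mul (measurable_sectionMoment _) ?_).aemeasurable
      unfold graphSlope
      fun_prop
  have hDt : D ≠ ⊤ := by
    intro h
    rw [h, ENNReal.top_mul hx0] at hO
    exact hOt hO
  have hSw : w * simplexMoment k (volume.restrict (graphBall n))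
      = D * volume (graphBall n) * y := by
    rw [hS, ← lintegral_const_mul' _ _ hwt, hD, ← lintegral_mul_const' _ _ hBt,
      ← lintegral_mul_const' _ _ hyt]
    refine lintegral_congr fun a => ?_
    rw [hB a]
    ring
  have hDB0 : D * volume (graphBall n) ≠ 0 := mul_ne_zero hD0 hB0
  have hDBt : D * volume (graphBall n) ≠ ⊤ := ENNReal.mul_ne_top hDt hBt
  have key : w * (2 ^ k * (volume (graphBall n) * originMoment k (volume.restrict (graphBall n))))
      < w * simplexMoment k (volume.restrict (graphBall n)) := by
    rw [hSw, hO, show w * (2 ^ k * (volume (graphBall n) * (D * x)))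
      = D * volume (graphBall n) * (2 ^ k * (x * w)) by ring]
    exact (ENNReal.mul_lt_mul_iff_right hDB0 hDBt).2 hlt
  exact lt_of_mul_lt_mul_left' key

lemma measure_pi_const_smul {ι α : Type*} [Fintype ι] [MeasurableSpace α] (ν : Measure α)
    [IsFiniteMeasure ν] (c : NNReal) :
    Measure.pi (fun _ : ι => c • ν)
      = (c : ENNReal) ^ Fintype.card ι • Measure.pi (fun _ : ι => ν) := by
  refine Measure.pi_eq fun s _ => ?_
  simp only [Measure.smul_apply, Measure.pi_pi, ENNReal.smul_def, smul_eq_mul,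
    Finset.prod_mul_distrib, Finset.prod_const, Finset.card_univ]

/-- The closed half-ball of `ℝ × ℝⁿ` in which the first coordinate is nonnegative. -/
def graphHalfBall (n : ℕ) : Set (ℝ × (Fin n → ℝ)) := graphBall n ∩ {x | 0 ≤ x.1}

lemma measurableSet_graphHalfBall (n : ℕ) : MeasurableSet (graphHalfBall n) :=
  (measurableSet_graphBall n).inter (measurableSet_le measurable_const measurable_fst)

lemma isCompact_graphHalfBall (n : ℕ) : IsCompact (graphHalfBall n) :=
  (isCompact_graphBall n).inter_right (isClosed_le continuous_const continuous_fst)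

instance (n : ℕ) : IsFiniteMeasure (volume.restrict (graphBall n)) :=
  ⟨by simpa using (isCompact_graphBall n).measure_lt_top⟩

instance (n : ℕ) : IsFiniteMeasure (volume.restrict (graphHalfBall n)) :=
  ⟨by simpa using (isCompact_graphHalfBall n).measure_lt_top⟩

/-- Integration over a subset of `ℝ × ℝⁿ`, along the first coordinate first. -/
lemma setLIntegral_prod_left {n : ℕ} {S : Set (ℝ × (Fin n → ℝ))} (hS : MeasurableSet S)
    {f : ℝ × (Fin n → ℝ) → ENNReal} (hf : Measurable f) :
    ∫⁻ x in S, f x = ∫⁻ y : Fin n → ℝ, ∫⁻ t : ℝ, S.indicator f (t, y) := by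
  rw [← lintegral_indicator hS, Measure.volume_eq_prod, ← lintegral_prod_swap,
    lintegral_prod _ (by exact ((hf.indicator hS).comp measurable_swap).aemeasurable)]
  rfl

lemma lintegral_eq_two_mul {r : ℝ} {f : ℝ → ENNReal} (hf : Measurable f) :
    ∫⁻ t, f t = 2 * ∫⁻ s, f (2 * s - r) := by
  have h := lintegral_eq_ofReal_pow_mul_lintegral_comp_smul (volume : Measure ℝ) two_pos (-r) hf
  simpa [neg_add_eq_sub] using h

/-- The map carrying each segment of the ball parallel to the first axis to its upper half. -/
noncomputable def upperHalfMap {n : ℕ} (x : ℝ × (Fin n → ℝ)) : ℝ × (Fin n → ℝ) :=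
  ((x.1 + √(1 - x.2 ⬝ᵥ x.2)) / 2, x.2)

@[fun_prop]
lemma measurable_upperHalfMap {n : ℕ} : Measurable (upperHalfMap (n := n)) := by
  unfold upperHalfMap; fun_prop

lemma map_upperHalfMap {n : ℕ} :
    (volume.restrict (graphBall n)).map upperHalfMap
      = (2 : NNReal) • volume.restrict (graphHalfBall n) := by
  refine Measure.ext_of_lintegral _ fun f hf => ?_
  rw [lintegral_map hf measurable_upperHalfMap, setLIntegral_prod_left (measurableSet_graphBall n)
    (by fun_prop), lintegral_smul_measure,
    setLIntegral_prod_left (measurableSet_graphHalfBall n) hf, ENNReal.smul_def, smul_eq_mul, ← lintegral_const_mul' _ _ (by simp)]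
  refine lintegral_congr fun y => ?_
  have hm : Measurable fun t : ℝ => (graphBall n).indicator (fun x => f (upperHalfMap x)) (t, y) :=
    (Measurable.indicator (by fun_prop) (measurableSet_graphBall n)).comp (by fun_prop)
  rw [lintegral_eq_two_mul (r := √(1 - y ⬝ᵥ y)) hm]
  congr 1
  refine lintegral_congr fun s => ?_
  have hu : upperHalfMap (2 * s - √(1 - y ⬝ᵥ y), y) = (s, y) := by
    simp [upperHalfMap]
  have hiff : (2 * s - √(1 - y ⬝ᵥ y), y) ∈ graphBall n ↔ (s, y) ∈ graphHalfBall n := by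
    simp only [graphBall, graphHalfBall, Set.mem_inter_iff, Set.mem_ofPred_eq]
    rcases le_or_gt (y ⬝ᵥ y) 1 with h | h
    · have h1 := Real.sq_sqrt (sub_nonneg.2 h)
      have h2 := Real.sqrt_nonneg (1 - y ⬝ᵥ y)
      set r := √(1 - y ⬝ᵥ y)
      constructor
      · intro h3
        have h4 : s * (s - r) ≤ 0 := by nlinarith
        have h5 : 0 ≤ s := by
          by_contra! hs
          nlinarith
        refine ⟨?_, h5⟩
        nlinarith
      · rintro ⟨h3, h4⟩
        have h5 : s ≤ r := by
          by_contra! hs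
          nlinarith
        nlinarith
    · constructor
      · intro h3
        nlinarith [sq_nonneg (2 * s - √(1 - y ⬝ᵥ y))]
      · rintro ⟨h3, h4⟩
        nlinarith [sq_nonneg s]
  by_cases h : (s, y) ∈ graphHalfBall n
  · rw [Set.indicator_of_mem h, Set.indicator_of_mem (hiff.2 h), hu]
  · rw [Set.indicator_of_notMem h, Set.indicator_of_notMem fun h' => h (hiff.1 h')]

/-- Reflection in the hyperplane orthogonal to the first axis. -/
def reflectFst {n : ℕ} (x : ℝ × (Fin n → ℝ)) : ℝ × (Fin n → ℝ) := (-x.1, x.2)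

@[fun_prop]
lemma measurable_reflectFst {n : ℕ} : Measurable (reflectFst (n := n)) := by
  unfold reflectFst; fun_prop

lemma map_reflectFst {n : ℕ} :
    (volume.restrict (graphBall n)).map reflectFst = volume.restrict (graphBall n) := by
  refine Measure.ext_of_lintegral _ fun f hf => ?_
  rw [lintegral_map hf measurable_reflectFst, setLIntegral_prod_left (measurableSet_graphBall n)
    (by fun_prop), setLIntegral_prod_left (measurableSet_graphBall n) hf]
  refine lintegral_congr fun y => ?_
  rw [← lintegral_neg_eq_self]
  refine lintegral_congr fun t => ?_
  have : (-t, y) ∈ graphBall n ↔ (t, y) ∈ graphBall n := by simp [graphBall]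
  by_cases h : (t, y) ∈ graphBall n
  · rw [Set.indicator_of_mem h, Set.indicator_of_mem (this.2 h)]
    simp [reflectFst]
  · rw [Set.indicator_of_notMem h, Set.indicator_of_notMem fun h' => h (this.1 h')]

/-- Point reflection of the points with negative first coordinate. -/
noncomputable def foldNeg {n : ℕ} (x : ℝ × (Fin n → ℝ)) : ℝ × (Fin n → ℝ) :=
  if 0 ≤ x.1 then x else -x

@[fun_prop]
lemma measurable_foldNeg {n : ℕ} : Measurable (foldNeg (n := n)) :=
  Measurable.ite (measurableSet_le measurable_const measurable_fst) measurable_id measurable_neg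

lemma map_foldNeg {n : ℕ} :
    (volume.restrict (graphBall n)).map foldNeg
      = (2 : NNReal) • volume.restrict (graphHalfBall n) := by
  refine Measure.ext_of_lintegral _ fun f hf => ?_
  have hP : MeasurableSet {x : ℝ × (Fin n → ℝ) | 0 ≤ x.1} :=
    measurableSet_le measurable_const measurable_fst
  rw [lintegral_map hf measurable_foldNeg, ← lintegral_indicator (measurableSet_graphBall n),
    ← lintegral_add_compl _ hP, lintegral_smul_measure, ENNReal.smul_def, smul_eq_mul]
  have h1 : ∫⁻ x in {x : ℝ × (Fin n → ℝ) | 0 ≤ x.1},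
      (graphBall n).indicator (fun x => f (foldNeg x)) x = ∫⁻ x in graphHalfBall n, f x := by
    rw [graphHalfBall, ← setLIntegral_indicator (measurableSet_graphBall n)]
    refine setLIntegral_congr_fun hP fun x hx => ?_
    have hx : 0 ≤ x.1 := hx
    by_cases h : x ∈ graphBall n
    · simp [h, foldNeg, hx]
    · simp [h]
  have h2 : ∫⁻ x in {x : ℝ × (Fin n → ℝ) | 0 ≤ x.1}ᶜ,
      (graphBall n).indicator (fun x => f (foldNeg x)) x = ∫⁻ x in graphHalfBall n, f x := by
    have h0 : (volume : Measure (ℝ × (Fin n → ℝ))) {x | x.1 = 0} = 0 := by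
      rw [show {x : ℝ × (Fin n → ℝ) | x.1 = 0} = {0} ×ˢ Set.univ by ext; simp,
        Measure.volume_eq_prod, Measure.prod_prod]
      simp
    have : (volume : Measure (ℝ × (Fin n → ℝ))).IsNegInvariant :=
      ⟨((Measure.measurePreserving_neg (volume : Measure ℝ)).prod
        (Measure.measurePreserving_neg (volume : Measure (Fin n → ℝ)))).map_eq⟩
    rw [← lintegral_indicator hP.compl, ← lintegral_neg_eq_self,
      ← lintegral_indicator (measurableSet_graphHalfBall n)]
    refine lintegral_congr_ae ?_
    filter_upwards [compl_mem_ae_iff.2 h0] with x hx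
    have hx : x.1 ≠ 0 := hx
    have hB : -x ∈ graphBall n ↔ x ∈ graphBall n := by simp [graphBall]
    have hN : -x ∈ {x : ℝ × (Fin n → ℝ) | 0 ≤ x.1}ᶜ ↔ 0 < x.1 := by simp
    have hH : x ∈ graphHalfBall n ↔ x ∈ graphBall n ∧ 0 < x.1 := by
      simp [graphHalfBall, hx.symm.le_iff_lt]
    by_cases h : 0 < x.1
    · rw [Set.indicator_of_mem (hN.2 h)]
      by_cases hb : x ∈ graphBall n
      · rw [Set.indicator_of_mem (hB.2 hb), Set.indicator_of_mem (hH.2 ⟨hb, h⟩)]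
        simp [foldNeg, h.not_ge]
      · rw [Set.indicator_of_notMem (fun h' => hb (hB.1 h')),
          Set.indicator_of_notMem (fun h' => hb (hH.1 h').1)]
    · rw [Set.indicator_of_notMem (fun h' => h (hN.1 h')),
        Set.indicator_of_notMem (fun h' => h (hH.1 h').2)]
  rw [h1, h2]
  simp [two_mul]

lemma lintegral_pi_map {ι α : Type*} [Fintype ι] [MeasurableSpace α] {ν ν' : Measure α}
    [IsFiniteMeasure ν] [IsFiniteMeasure ν'] {φ : α → α} (hφ : Measurable φ) (c : NNReal)
    (h : ν.map φ = c • ν') {f : (ι → α) → ENNReal} (hf : Measurable f) :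
    ∫⁻ z, f (fun i => φ (z i)) ∂Measure.pi (fun _ : ι => ν)
      = (c : ENNReal) ^ Fintype.card ι * ∫⁻ z, f z ∂Measure.pi (fun _ : ι => ν') := by
  have h1 : (Measure.pi (fun _ : ι => ν)).map (fun z i => φ (z i))
      = Measure.pi (fun _ : ι => c • ν') := by
    rw [Measure.pi_map_pi fun _ => hφ.aemeasurable, h]
  rw [← smul_eq_mul, ← lintegral_smul_measure, ← measure_pi_const_smul, ← h1,
    lintegral_map hf (by fun_prop)]

lemma abs_lastColDet_foldNeg {n : ℕ} (z : Fin (n + 1) → ℝ × (Fin n → ℝ)) :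
    |lastColDet (fun i => (foldNeg (z i)).2) (fun i => (foldNeg (z i)).1)|
      = |lastColDet (fun i => (z i).2) (fun i => (z i).1)| := by
  set ε : Fin (n + 1) → ℝ := fun i => if 0 ≤ (z i).1 then 1 else -1
  have hε : |∏ i, ε i| = 1 := by
    rw [Finset.abs_prod]
    refine Finset.prod_eq_one fun i _ => ?_
    by_cases h : 0 ≤ (z i).1 <;> simp [ε, h]
  rw [lastColDet_eq_det, lastColDet_eq_det, ← one_mul |Matrix.det (Matrix.of fun i => Fin.snoc
    (α := fun _ => ℝ) (z i).2 (z i).1)|, ← hε, ← abs_mul, ← Matrix.det_mul_column]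
  congr 2
  ext i j
  by_cases h : 0 ≤ (z i).1 <;> refine Fin.lastCases ?_ (fun j => ?_) j <;>
    simp [ε, h, foldNeg]

lemma originMoment_graphBall_eq {n : ℕ} (k : ℕ) :
    originMoment k (volume.restrict (graphBall n))
      = 2 ^ (n + 1) * originMoment k (volume.restrict (graphHalfBall n)) := by
  have h := lintegral_pi_map (ι := Fin (n + 1)) measurable_foldNeg 2 (map_foldNeg (n := n))
    (f := fun z => ENNReal.ofReal |lastColDet (fun i => (z i).2) (fun i => (z i).1)| ^ k)
    (by fun_prop)
  simpa [abs_lastColDet_foldNeg, originMoment] using h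

lemma volume_graphBall_eq_two_mul (n : ℕ) :
    volume (graphBall n) = 2 * volume (graphHalfBall n) := by
  have h := congrArg (fun μ => μ Set.univ) (map_foldNeg (n := n))
  simpa [Measure.map_apply measurable_foldNeg, ENNReal.smul_def] using h

lemma lastColDet_const_mul_add {n : ℕ} (y : Fin (n + 1) → Fin n → ℝ) (s t : Fin (n + 1) → ℝ)
    (c : ℝ) : lastColDet y (fun i => c * (s i + t i)) = c * (lastColDet y s + lastColDet y t) := by
  have : (fun i => c * (s i + t i)) = c • (s + t) := rfl
  rw [this]
  simp [lastColDet, map_add, map_smul, mul_add]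

lemma lastColDet_neg {n : ℕ} (y : Fin (n + 1) → Fin n → ℝ) (t : Fin (n + 1) → ℝ) :
    lastColDet y (fun i => -t i) = -lastColDet y t := by
  have : (fun i => -t i) = -t := rfl
  rw [this]
  simp [lastColDet, map_neg]

lemma lintegral_lintegral_pi_map {ι α : Type*} [Fintype ι] [MeasurableSpace α] {ν ν' : Measure α}
    [IsFiniteMeasure ν] [IsFiniteMeasure ν'] {φ : α → α} (hφ : Measurable φ) (c : NNReal)
    (h : ν.map φ = c • ν') {f : (ι → α) → α → ENNReal} (hf : Measurable (Function.uncurry f)) :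
    ∫⁻ z, ∫⁻ x, f (fun i => φ (z i)) (φ x) ∂ν ∂Measure.pi (fun _ : ι => ν)
      = (c : ENNReal) ^ (Fintype.card ι + 1) *
        ∫⁻ z, ∫⁻ x, f z x ∂ν' ∂Measure.pi (fun _ : ι => ν') := by
  have h1 : ∀ z : ι → α, ∫⁻ x, f z (φ x) ∂ν = c * ∫⁻ x, f z x ∂ν' := fun z => by
    rw [← smul_eq_mul, ← ENNReal.smul_def, ← lintegral_smul_measure, ← h,
      lintegral_map (by fun_prop) hφ]
  simp_rw [h1]
  rw [lintegral_const_mul' _ _ (by simp), lintegral_pi_map hφ c h (f := fun z => ∫⁻ x, f z x ∂ν')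
    hf.lintegral_prod_right]
  ring

lemma two_mul_abs_pow_le_add (k : ℕ) (u s : ℝ) :
    2 * ENNReal.ofReal |u| ^ k ≤ 2 ^ k *
      (ENNReal.ofReal |1 / 2 * (u + s)| ^ k + ENNReal.ofReal |1 / 2 * (-u + s)| ^ k) := by
  simp only [← ENNReal.ofReal_pow (abs_nonneg _)]
  rw [← ENNReal.ofReal_add (by positivity) (by positivity), ← ENNReal.ofReal_ofNat,
    ← ENNReal.ofReal_pow (by positivity),
    ← ENNReal.ofReal_mul (by positivity), ← ENNReal.ofReal_mul (by positivity)]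
  refine ENNReal.ofReal_le_ofReal ?_
  have h1 : |u| ≤ 2 * (1 / 2 * |1 / 2 * (u + s)| + 1 / 2 * |1 / 2 * (-u + s)|) := by
    have h := abs_sub (1 / 2 * (u + s)) (1 / 2 * (-u + s))
    rw [show 1 / 2 * (u + s) - 1 / 2 * (-u + s) = u by ring] at h
    linarith
  have h2 := (convexOn_pow (𝕜 := ℝ) k).2 (abs_nonneg (1 / 2 * (u + s)))
    (abs_nonneg (1 / 2 * (-u + s))) (by norm_num : (0 : ℝ) ≤ 1 / 2)
    (by norm_num : (0 : ℝ) ≤ 1 / 2) (by norm_num)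
  have h3 := pow_le_pow_left₀ (abs_nonneg _) h1 k
  rw [mul_pow] at h3
  simp only [smul_eq_mul] at h2
  have h4 := mul_le_mul_of_nonneg_left h2 (pow_nonneg zero_le_two k : (0 : ℝ) ≤ 2 ^ k)
  linarith

lemma lintegral_lintegral_add {α β : Type*} [MeasurableSpace α] [MeasurableSpace β]
    {μ : Measure α} {ν : Measure β} [SFinite ν] {f g : α → β → ENNReal}
    (hf : Measurable (Function.uncurry f)) :
    ∫⁻ x, ∫⁻ y, (f x y + g x y) ∂ν ∂μ = ∫⁻ x, ∫⁻ y, f x y ∂ν ∂μ + ∫⁻ x, ∫⁻ y, g x y ∂ν ∂μ := by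
  rw [← lintegral_add_left hf.lintegral_prod_right]
  exact lintegral_congr fun x => lintegral_add_left (hf.comp measurable_prodMk_left) _

lemma simplexMoment_graphBall_le {n : ℕ} (k : ℕ) :
    simplexMoment k (volume.restrict (graphBall n))
      ≤ 2 ^ k * (2 ^ (n + 2) * simplexMoment k (volume.restrict (graphHalfBall n))) := by
  set ν := volume.restrict (graphBall n) with hν
  set F : (Fin (n + 1) → ℝ × (Fin n → ℝ)) → ℝ × (Fin n → ℝ) → ENNReal := fun z x =>
    ENNReal.ofReal |lastColDet (fun i => (z i).2 - x.2) (fun i => (z i).1 - x.1)| ^ k with hFdef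
  have hF : Measurable (Function.uncurry F) := by
    simp only [F, Function.uncurry_def]
    fun_prop
  have hG : Measurable (Function.uncurry fun (z : Fin (n + 1) → ℝ × (Fin n → ℝ)) x =>
      F (fun i => upperHalfMap (z i)) (upperHalfMap x)) := by
    simp only [F, Function.uncurry_def]
    fun_prop
  have h1 : ∫⁻ z, ∫⁻ x, F (fun i => upperHalfMap (z i)) (upperHalfMap x) ∂ν
      ∂Measure.pi (fun _ : Fin (n + 1) => ν)
      = 2 ^ (n + 2) * simplexMoment k (volume.restrict (graphHalfBall n)) := by
    rw [lintegral_lintegral_pi_map measurable_upperHalfMap 2 map_upperHalfMap hF]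
    simp [simplexMoment, hFdef]
  have h2 : ∫⁻ z, ∫⁻ x, F (fun i => upperHalfMap (reflectFst (z i))) (upperHalfMap (reflectFst x))
      ∂ν ∂Measure.pi (fun _ : Fin (n + 1) => ν)
      = 2 ^ (n + 2) * simplexMoment k (volume.restrict (graphHalfBall n)) := by
    rw [lintegral_lintegral_pi_map measurable_reflectFst 1
      (map_reflectFst.trans (one_smul NNReal ν).symm) hG, h1]
    simp
  have key : ∀ z x, 2 * F z x ≤ 2 ^ k * (F (fun i => upperHalfMap (z i)) (upperHalfMap x)
      + F (fun i => upperHalfMap (reflectFst (z i))) (upperHalfMap (reflectFst x))) := by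
    intro z x
    have h := two_mul_abs_pow_le_add k
      (lastColDet (fun i => (z i).2 - x.2) (fun i => (z i).1 - x.1))
      (lastColDet (fun i => (z i).2 - x.2)
        (fun i => √(1 - (z i).2 ⬝ᵥ (z i).2) - √(1 - x.2 ⬝ᵥ x.2)))
    rw [← lastColDet_neg, ← lastColDet_const_mul_add, ← lastColDet_const_mul_add] at h
    convert h using 6 <;> simp only [upperHalfMap, reflectFst] <;> congr 2 <;> ext i <;> ring
  have hsum : 2 * simplexMoment k ν ≤
      2 * (2 ^ k * (2 ^ (n + 2) * simplexMoment k (volume.restrict (graphHalfBall n)))) := by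
    calc 2 * simplexMoment k ν
        = ∫⁻ z, ∫⁻ x, 2 * F z x ∂ν ∂Measure.pi (fun _ : Fin (n + 1) => ν) := by
          simp_rw [lintegral_const_mul' _ _ ENNReal.ofNat_ne_top]
          rfl
      _ ≤ ∫⁻ z, ∫⁻ x, 2 ^ k * (F (fun i => upperHalfMap (z i)) (upperHalfMap x)
            + F (fun i => upperHalfMap (reflectFst (z i))) (upperHalfMap (reflectFst x)))
            ∂ν ∂Measure.pi (fun _ : Fin (n + 1) => ν) :=
          lintegral_mono fun z => lintegral_mono fun x => key z x
      _ = 2 ^ k * (2 ^ (n + 2) * simplexMoment k (volume.restrict (graphHalfBall n))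
            + 2 ^ (n + 2) * simplexMoment k (volume.restrict (graphHalfBall n))) := by
          simp_rw [lintegral_const_mul' _ _ (ENNReal.pow_ne_top ENNReal.ofNat_ne_top)]
          congr 1
          nth_rw 2 [← h2]
          rw [← h1, lintegral_lintegral_add hG]
      _ = _ := by ring
  exact (ENNReal.mul_le_mul_iff_right two_ne_zero ENNReal.ofNat_ne_top).1 hsum

/-- The comparison of moments for the half-ball. -/
lemma volume_mul_originMoment_graphHalfBall_lt {n k : ℕ} (hn : 3 ≤ n) (hk : 1 ≤ k) :
    volume (graphHalfBall n) * originMoment k (volume.restrict (graphHalfBall n))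
      < simplexMoment k (volume.restrict (graphHalfBall n)) := by
  have h := (two_pow_mul_originMoment_graphBall_lt hn hk).trans_le (simplexMoment_graphBall_le k)
  rw [originMoment_graphBall_eq, volume_graphBall_eq_two_mul] at h
  rw [ENNReal.mul_lt_mul_iff_right (by simp) (ENNReal.pow_ne_top ENNReal.ofNat_ne_top),
    show ∀ a b : ENNReal, 2 * a * (2 ^ (n + 1) * b) = 2 ^ (n + 2) * (a * b) from
      fun a b => by ring,
    ENNReal.mul_lt_mul_iff_right (by simp) (ENNReal.pow_ne_top ENNReal.ofNat_ne_top)] at h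
  exact h

/-- The coordinates of a point of Euclidean space, with the last one singled out. -/
def graphCoord {n : ℕ} (x : EuclideanSpace ℝ (Fin (n + 1))) : ℝ × (Fin n → ℝ) :=
  (x (Fin.last n), fun j => x j.castSucc)

lemma measurePreserving_graphCoord (n : ℕ) :
    MeasurePreserving (graphCoord (n := n)) volume volume := by
  have h := (volume_preserving_piFinSuccAbove (fun _ : Fin (n + 1) => ℝ) (Fin.last n)).comp
    (PiLp.volume_preserving_ofLp (Fin (n + 1)))
  have e : graphCoord (n := n) = MeasurableEquiv.piFinSuccAbove (fun _ : Fin (n + 1) => ℝ)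
      (Fin.last n) ∘ WithLp.ofLp := by
    ext x j
    · rfl
    · simp [graphCoord, MeasurableEquiv.piFinSuccAbove, Fin.init]
  rw [e]
  exact h

@[fun_prop]
lemma continuous_graphCoord {n : ℕ} : Continuous (graphCoord (n := n)) := by
  unfold graphCoord; fun_prop

lemma graphCoord_preimage_graphHalfBall (n : ℕ) :
    graphCoord ⁻¹' graphHalfBall n = {x : EuclideanSpace ℝ (Fin (n + 1)) |
      ‖x‖ ≤ 1 ∧ 0 ≤ x (Fin.last n)} := by
  ext x
  simp only [Set.mem_preimage, graphHalfBall, graphBall, graphCoord, Set.mem_inter_iff,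
    Set.mem_ofPred_eq]
  rw [← sq_le_one_iff₀ (norm_nonneg x), EuclideanSpace.norm_sq_eq, Fin.sum_univ_castSucc]
  simp [dotProduct, pow_two, add_comm]

/-- The simplex spanned by the origin and the standard basis vectors. -/
def cornerSimplex (m : ℕ) : Set (EuclideanSpace ℝ (Fin m)) :=
  convexHull ℝ (insert 0 (Set.range (EuclideanSpace.basisFun (Fin m) ℝ)))

lemma volume_cornerSimplex_ne_top (m : ℕ) : volume (cornerSimplex m) ≠ ⊤ :=
  (((Set.finite_range _).insert 0).isCompact_convexHull ℝ).measure_lt_top.ne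

lemma volume_cornerSimplex_ne_zero (m : ℕ) : volume (cornerSimplex m) ≠ 0 := by
  refine (Measure.measure_pos_of_nonempty_interior volume ?_).ne'
  rw [cornerSimplex, interior_convexHull_nonempty_iff_affineSpan_eq_top, ← SetLike.coe_set_eq]
  have := (EuclideanSpace.basisFun (Fin m) ℝ).toBasis.span_eq
  rw [OrthonormalBasis.coe_toBasis] at this
  rw [affineSpan_insert_zero, this]
  rfl

lemma volume_convexHull_insert_zero {m : ℕ} (X : Fin m → EuclideanSpace ℝ (Fin m)) :
    volume (convexHull ℝ (insert 0 (Set.range X)))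
      = volume (cornerSimplex m) * ENNReal.ofReal |(Matrix.of fun i j => X i j).det| := by
  set b := (EuclideanSpace.basisFun (Fin m) ℝ).toBasis
  set L := b.constr ℝ X
  have h1 : convexHull ℝ (insert 0 (Set.range X)) = L '' cornerSimplex m := by
    rw [cornerSimplex, L.image_convexHull, Set.image_insert_eq, map_zero, ← Set.range_comp,
      ← OrthonormalBasis.coe_toBasis]
    congr! 3
    ext i : 1
    exact (b.constr_basis ℝ X i).symm
  have h2 : LinearMap.det L = (Matrix.of fun i j => X i j).det := by
    rw [← LinearMap.det_toMatrix b, ← Matrix.det_transpose]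
    congr 1
    ext i j
    simp [LinearMap.toMatrix_apply, L, b]
  rw [h1, Measure.addHaar_image_linearMap, h2, mul_comm]

lemma volume_convexHull_insert_zero_eq_lastColDet {n : ℕ}
    (X : Fin (n + 1) → EuclideanSpace ℝ (Fin (n + 1))) :
    volume (convexHull ℝ (insert 0 (Set.range X))) = volume (cornerSimplex (n + 1)) *
      ENNReal.ofReal |lastColDet (fun i => (graphCoord (X i)).2)
        (fun i => (graphCoord (X i)).1)| := by
  rw [volume_convexHull_insert_zero, lastColDet_eq_det]
  congr 5
  ext i j
  refine Fin.lastCases ?_ (fun j => ?_) j <;> simp [graphCoord]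

open scoped Pointwise in
lemma volume_convexHull_range_eq_lastColDet {n : ℕ}
    (X : Fin (n + 2) → EuclideanSpace ℝ (Fin (n + 1))) :
    volume (convexHull ℝ (Set.range X)) = volume (cornerSimplex (n + 1)) *
      ENNReal.ofReal |lastColDet
        (fun i : Fin (n + 1) => (graphCoord (X i.succ)).2 - (graphCoord (X 0)).2)
        (fun i : Fin (n + 1) => (graphCoord (X i.succ)).1 - (graphCoord (X 0)).1)| := by
  have h : Set.range X = X 0 +ᵥ insert 0 (Set.range fun i : Fin (n + 1) => X i.succ - X 0) := by
    ext v
    simp [Set.mem_vadd_set, Fin.exists_fin_succ, eq_comm]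
  rw [h, convexHull_vadd, measure_vadd, volume_convexHull_insert_zero_eq_lastColDet]
  rfl

lemma measurePreserving_graphCoord_restrict (n : ℕ) :
    MeasurePreserving (graphCoord (n := n))
      (volume.restrict (graphCoord ⁻¹' graphHalfBall n)) (volume.restrict (graphHalfBall n)) :=
  (measurePreserving_graphCoord n).restrict_preimage (measurableSet_graphHalfBall n)

lemma lintegral_volume_convexHull_insert_zero (n k : ℕ) :
    ∫⁻ X in Set.univ.pi fun _ : Fin (n + 1) => graphCoord ⁻¹' graphHalfBall n,
        volume (convexHull ℝ (insert 0 (Set.range X))) ^ k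
      = volume (cornerSimplex (n + 1)) ^ k
        * originMoment k (volume.restrict (graphHalfBall n)) := by
  simp_rw [volume_convexHull_insert_zero_eq_lastColDet, mul_pow]
  rw [lintegral_const_mul' _ _ (ENNReal.pow_ne_top (volume_cornerSimplex_ne_top _)), originMoment,
    volume_pi, Measure.restrict_pi_pi,
    ← (measurePreserving_pi _ _ fun _ => measurePreserving_graphCoord_restrict n).lintegral_comp
      (by fun_prop)]

lemma lintegral_volume_convexHull_range (n k : ℕ) :
    ∫⁻ X in Set.univ.pi fun _ : Fin (n + 2) => graphCoord ⁻¹' graphHalfBall n,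
        volume (convexHull ℝ (Set.range X)) ^ k
      = volume (cornerSimplex (n + 1)) ^ k
        * simplexMoment k (volume.restrict (graphHalfBall n)) := by
  simp_rw [volume_convexHull_range_eq_lastColDet, mul_pow]
  rw [lintegral_const_mul' _ _ (ENNReal.pow_ne_top (volume_cornerSimplex_ne_top _)), simplexMoment,
    volume_pi, Measure.restrict_pi_pi,
    (measurePreserving_pi _ _ fun _ => measurePreserving_graphCoord_restrict n).lintegral_comp
      (f := fun z : Fin (n + 2) → ℝ × (Fin n → ℝ) => ENNReal.ofReal |lastColDet
        (fun i : Fin (n + 1) => (z i.succ).2 - (z 0).2)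
        (fun i : Fin (n + 1) => (z i.succ).1 - (z 0).1)| ^ k)
      (by fun_prop),
    ← (measurePreserving_piFinSuccAbove _ 0).symm.lintegral_comp (by fun_prop),
    ← lintegral_prod_swap, lintegral_prod _ (by fun_prop)]
  rfl

lemma simplexMoment_restrict_ne_top {n : ℕ} (k : ℕ) {S : Set (ℝ × (Fin n → ℝ))}
    (hS : IsCompact S) : simplexMoment k (volume.restrict S) ≠ ⊤ := by
  have hc : IsCompact ((Set.univ.pi fun _ : Fin (n + 1) => S) ×ˢ S) :=
    (isCompact_univ_pi fun _ => hS).prod hS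
  have := (ContinuousOn.integrableOn_compact
    (f := fun p : (Fin (n + 1) → ℝ × (Fin n → ℝ)) × (ℝ × (Fin n → ℝ)) =>
      |lastColDet (fun i => (p.1 i).2 - p.2.2) (fun i => (p.1 i).1 - p.2.1)| ^ k)
    (μ := (volume : Measure (Fin (n + 1) → ℝ × (Fin n → ℝ))).prod volume) hc
    (Continuous.continuousOn (by fun_prop))).lintegral_lt_top
  simp only [ENNReal.ofReal_pow (abs_nonneg _)] at this
  rw [← Measure.prod_restrict, volume_pi, Measure.restrict_pi_pi,
    lintegral_prod _ (by fun_prop)] at this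
  exact this.ne

lemma setAverage_toReal_pow {ι α : Type*} [Fintype ι] [MeasureSpace α]
    [SigmaFinite (volume : Measure α)] (K : Set α) {F : (ι → α) → ENNReal} (hF : Measurable F)
    (hF' : ∀ X, F X ≠ ⊤) (k : ℕ) :
    ⨍ X in Set.univ.pi (fun _ : ι => K), (F X).toReal ^ k
      = ((∫⁻ X in Set.univ.pi (fun _ : ι => K), F X ^ k) / volume K ^ Fintype.card ι).toReal := by
  simp_rw [← ENNReal.toReal_pow]
  rw [← toReal_setLAverage (by fun_prop) (.of_forall fun X => ENNReal.pow_ne_top (hF' X)),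
    setLAverage_eq, volume_pi_pi, Finset.prod_const, Finset.card_univ]

/-- For `d ≥ 4` and `K` the closed upper unit half-ball
`{x : ‖x‖ ≤ 1, x_d ≥ 0}` in `ℝ^d`, for every integer `k ≥ 1` the `k`-th moment
of the volume of the simplex spanned by the origin and `d` independent uniform
points in `K` is strictly smaller than `E(V_K^k)`. -/
theorem halfBall_origin_moment_lt_simplex_moment
    (d : ℕ) (hd : 4 ≤ d)
    (K : Set (EuclideanSpace ℝ (Fin d)))
    (hK : K = {x : EuclideanSpace ℝ (Fin d) |
        ‖x‖ ≤ 1 ∧ 0 ≤ x ⟨d - 1, by omega⟩})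
    (k : ℕ) (hk : 1 ≤ k) :
    (⨍ X : Fin d → EuclideanSpace ℝ (Fin d) in Set.univ.pi (fun _ => K),
        (volume (convexHull ℝ (insert 0 (Set.range X)))).toReal ^ k) <
      ⨍ X : Fin (d + 1) → EuclideanSpace ℝ (Fin d) in Set.univ.pi (fun _ => K),
        (volume (convexHull ℝ (Set.range X))).toReal ^ k := by
  obtain ⟨n, rfl⟩ : ∃ n, d = n + 1 := ⟨d - 1, by omega⟩
  have hKn : K = graphCoord ⁻¹' graphHalfBall n :=
    hK.trans (graphCoord_preimage_graphHalfBall n).symm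
  have hlt := volume_mul_originMoment_graphHalfBall_lt (n := n) (by omega) hk
  have hV : volume K = volume (graphHalfBall n) := by
    rw [hKn, (measurePreserving_graphCoord n).measure_preimage
      (measurableSet_graphHalfBall n).nullMeasurableSet]
  have hV0 : volume (graphHalfBall n) ≠ 0 := fun h => by
    simp [Measure.restrict_eq_zero.2 h, simplexMoment] at hlt
  have hVt : volume (graphHalfBall n) ≠ ⊤ := (isCompact_graphHalfBall n).measure_lt_top.ne
  have hSt := simplexMoment_restrict_ne_top k (isCompact_graphHalfBall n)
  have hc0 := pow_ne_zero k (volume_cornerSimplex_ne_zero (n + 1))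
  have hct : volume (cornerSimplex (n + 1)) ^ k ≠ ⊤ :=
    ENNReal.pow_ne_top (volume_cornerSimplex_ne_top (n + 1))
  rw [setAverage_toReal_pow K, setAverage_toReal_pow K, hV, hKn,
    lintegral_volume_convexHull_insert_zero, lintegral_volume_convexHull_range, Fintype.card_fin,
    Fintype.card_fin]
  · refine ENNReal.toReal_strict_mono
      (ENNReal.div_ne_top (ENNReal.mul_ne_top hct hSt) (pow_ne_zero _ hV0)) ?_
    rw [ENNReal.lt_div_iff_mul_lt (.inl (pow_ne_zero _ hV0)) (.inl (ENNReal.pow_ne_top hVt)),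
      pow_succ _ (n + 1), ← mul_assoc,
      ENNReal.div_mul_cancel (pow_ne_zero _ hV0) (ENNReal.pow_ne_top hVt), mul_assoc,
      ENNReal.mul_lt_mul_iff_right hc0 hct, mul_comm]
    exact hlt
  · simp_rw [volume_convexHull_range_eq_lastColDet]
    fun_prop
  · exact fun X => ((Set.finite_range X).isCompact_convexHull ℝ).measure_lt_top.ne
  · simp_rw [volume_convexHull_insert_zero_eq_lastColDet]
    fun_prop
  · exact fun X => (((Set.finite_range X).insert 0).isCompact_convexHull ℝ).measure_lt_top.ne
end

section
/- Fix a real p with 1 ≤ p < ∞. The following are equivalent: (i) there exists a constant c_1 > 0 such that for every dimension d and every pair of convex bodies K ⊆ M ⊆ ℝ^d one has det A(K) ≤ c_1^d · det A(M); (ii) there exists a constant c_2 > 0 such that for every dimension d and every pair of convex bodies K ⊆ M ⊆ ℝ^d one has E(V_K^p) ≤ c_2^d · E(V_M^p). -/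
open MeasureTheory

/-- A convex body in `ℝ^d`: a compact convex set with nonempty interior. -/
def IsConvexBody {d : ℕ} (K : Set (EuclideanSpace ℝ (Fin d))) : Prop :=
  IsCompact K ∧ Convex ℝ K ∧ (interior K).Nonempty

/-- The centroid `μ(K)` of `K`: the expectation of a uniformly random point of `K`. -/
noncomputable def centroid {d : ℕ} (K : Set (EuclideanSpace ℝ (Fin d))) :
    EuclideanSpace ℝ (Fin d) :=
  ⨍ x in K, x

/-- The covariance matrix `A(K)` of a uniformly random point of `K`. -/
noncomputable def covMatrix {d : ℕ} (K : Set (EuclideanSpace ℝ (Fin d))) :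
    Matrix (Fin d) (Fin d) ℝ :=
  Matrix.of fun i j => ⨍ x in K, (x i - centroid K i) * (x j - centroid K j)

/-- `E(V_K^p)`: the `p`-th moment (real `p`) of the volume of the convex hull
of `d+1` independent uniformly random points in `K`. -/
noncomputable def momentVolSimplexReal (d : ℕ) (p : ℝ)
    (K : Set (EuclideanSpace ℝ (Fin d))) : ℝ :=
  ⨍ X : Fin (d + 1) → EuclideanSpace ℝ (Fin d) in Set.univ.pi (fun _ => K),
    (volume (convexHull ℝ (Set.range X))).toReal ^ p

theorem Real.volume_add_volume_le_two_mul_of_isCompact {A B S : Set ℝ} (hA : IsCompact A)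
    (hB : IsCompact B) (hA0 : A.Nonempty) (hB0 : B.Nonempty)
    (h : ∀ a ∈ A, ∀ b ∈ B, (1 / 2 : ℝ) * (a + b) ∈ S) :
    volume A + volume B ≤ 2 * volume S := by
  obtain ⟨a₀, ha₀, hmax⟩ := hA.exists_isGreatest hA0
  obtain ⟨b₀, hb₀, hmin⟩ := hB.exists_isLeast hB0
  set T : Set ℝ := (fun x => 2 * x) '' S with hT
  have hTvol : volume T = 2 * volume S := by
    have := Measure.addHaar_smul (volume : Measure ℝ) 2 S
    simpa [← Set.image_smul, hT] using this
  have h1 : (fun x => x + b₀) '' A ⊆ T := by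
    rintro _ ⟨a, ha, rfl⟩
    exact ⟨_, h a ha b₀ hb₀, by ring⟩
  have h2 : (fun x => x + a₀) '' B ⊆ T := by
    rintro _ ⟨b, hb, rfl⟩
    exact ⟨_, h a₀ ha₀ b hb, by ring⟩
  have hmeas : MeasurableSet ((fun x => x + a₀) '' B) :=
    (hB.image (by fun_prop)).measurableSet
  have hdisj : AEDisjoint volume ((fun x => x + b₀) '' A) ((fun x => x + a₀) '' B) := by
    refine measure_mono_null (t := {a₀ + b₀}) ?_ (by simp)
    rintro _ ⟨⟨a, ha, rfl⟩, ⟨b, hb, hab⟩⟩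
    have h3 := hmax ha
    have h4 := hmin hb
    simp only [Set.mem_singleton_iff] at hab ⊢
    linarith
  calc volume A + volume B
      = volume ((fun x => x + b₀) '' A) + volume ((fun x => x + a₀) '' B) := by simp
    _ = volume ((fun x => x + b₀) '' A ∪ (fun x => x + a₀) '' B) :=
        (measure_union₀ hmeas.nullMeasurableSet hdisj).symm
    _ ≤ volume T := measure_mono (Set.union_subset h1 h2)
    _ = 2 * volume S := hTvol

theorem Real.volume_add_volume_le_two_mul {A B S : Set ℝ} (hA : MeasurableSet A)
    (hB : MeasurableSet B) (hA0 : A.Nonempty) (hB0 : B.Nonempty)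
    (h : ∀ a ∈ A, ∀ b ∈ B, (1 / 2 : ℝ) * (a + b) ∈ S) :
    volume A + volume B ≤ 2 * volume S := by
  obtain ⟨a₀, ha₀⟩ := hA0
  obtain ⟨b₀, hb₀⟩ := hB0
  rw [hA.measure_eq_iSup_isCompact, hB.measure_eq_iSup_isCompact]
  simp only [iSup_and']
  have key : ∀ K₁ ⊆ A, IsCompact K₁ → ∀ K₂ ⊆ B, IsCompact K₂ →
      volume K₁ + volume K₂ ≤ 2 * volume S := by
    intro K₁ h₁ hc₁ K₂ h₂ hc₂
    refine le_trans (add_le_add (measure_mono (Set.subset_insert a₀ K₁))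
      (measure_mono (Set.subset_insert b₀ K₂))) ?_
    refine Real.volume_add_volume_le_two_mul_of_isCompact (hc₁.insert a₀) (hc₂.insert b₀)
      (Set.insert_nonempty _ _) (Set.insert_nonempty _ _) fun a ha b hb => h a ?_ b ?_
    · exact Set.insert_subset ha₀ h₁ ha
    · exact Set.insert_subset hb₀ h₂ hb
  refine ENNReal.biSup_add_biSup_le' ?_ ?_ ?_
  · exact ⟨∅, by simp⟩
  · exact ⟨∅, by simp⟩
  · exact fun i hi j hj => key i hi.1 hi.2 j hj.1 hj.2

theorem MeasureTheory.lintegral_eq_lintegral_meas_ofReal_lt {α : Type*} [MeasurableSpace α]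
    (μ : Measure α) [SFinite μ] {u : α → ENNReal} (hu : Measurable u) :
    ∫⁻ x, u x ∂μ = ∫⁻ t in Set.Ioi (0 : ℝ), μ {x | ENNReal.ofReal t < u x} := by
  have h1 : ∀ c : ENNReal,
      c = ∫⁻ t in Set.Ioi (0 : ℝ), Set.indicator {t : ℝ | ENNReal.ofReal t < c} 1 t := by
    intro c
    have hm : MeasurableSet {t : ℝ | ENNReal.ofReal t < c} :=
      measurableSet_lt (by fun_prop) measurable_const
    rw [lintegral_indicator_one hm, Measure.restrict_apply hm]
    induction c with
    | top => simp
    | coe c =>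
      have : {t : ℝ | ENNReal.ofReal t < c} ∩ Set.Ioi 0 = Set.Ioo 0 (c : ℝ) := by
        ext t
        simp only [Set.mem_inter_iff, Set.mem_ofPred_eq, Set.mem_Ioi, Set.mem_Ioo]
        rw [and_comm]
        refine and_congr_right fun ht => ?_
        rw [← ENNReal.ofReal_coe_nnreal, ENNReal.ofReal_lt_ofReal_iff_of_nonneg ht.le]
      rw [this]
      simp
  have hm : MeasurableSet {q : α × ℝ | ENNReal.ofReal q.2 < u q.1} :=
    measurableSet_lt (by fun_prop) (hu.comp measurable_fst)
  calc ∫⁻ x, u x ∂μ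
      = ∫⁻ x, (∫⁻ t in Set.Ioi (0 : ℝ),
          Set.indicator {q : α × ℝ | ENNReal.ofReal q.2 < u q.1} 1 (x, t)) ∂μ := by
        refine lintegral_congr fun x => ?_
        conv_lhs => rw [h1 (u x)]
        rfl
    _ = ∫⁻ t in Set.Ioi (0 : ℝ), (∫⁻ x,
          Set.indicator {q : α × ℝ | ENNReal.ofReal q.2 < u q.1} 1 (x, t) ∂μ) := by
        refine lintegral_lintegral_swap ?_
        exact (measurable_one.indicator hm).aemeasurable
    _ = _ := by
        refine lintegral_congr fun t => ?_
        have hmt : MeasurableSet {x | ENNReal.ofReal t < u x} :=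
          measurableSet_lt measurable_const hu
        rw [← lintegral_indicator_one hmt]
        rfl

theorem lintegral_add_lintegral_le_of_iSup_eq_one {f g h : ℝ → ENNReal} (hf : Measurable f)
    (hg : Measurable g) (hh : Measurable h) (hf1 : ⨆ x, f x = 1) (hg1 : ⨆ x, g x = 1)
    (H : ∀ x y, f x * g y ≤ h ((1 / 2 : ℝ) * (x + y)) ^ 2) :
    (∫⁻ x, f x) + ∫⁻ x, g x ≤ 2 * ∫⁻ x, h x := by
  have hm : ∀ {u : ℝ → ENNReal}, Measurable u →
      Measurable fun t : ℝ => volume {x | ENNReal.ofReal t < u x} := by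
    intro u hu
    have hm : MeasurableSet {q : ℝ × ℝ | ENNReal.ofReal q.1 < u q.2} :=
      measurableSet_lt (by fun_prop) (hu.comp measurable_snd)
    exact measurable_measure_prodMk_left hm
  rw [lintegral_eq_lintegral_meas_ofReal_lt _ hf, lintegral_eq_lintegral_meas_ofReal_lt _ hg,
    lintegral_eq_lintegral_meas_ofReal_lt _ hh, ← lintegral_add_left (hm hf),
    ← lintegral_const_mul _ (hm hh)]
  refine lintegral_mono fun t => ?_
  by_cases ht : ENNReal.ofReal t < 1
  · refine Real.volume_add_volume_le_two_mul (measurableSet_lt measurable_const hf)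
      (measurableSet_lt measurable_const hg) ?_ ?_ ?_
    · rw [← hf1] at ht
      exact lt_iSup_iff.1 ht
    · rw [← hg1] at ht
      exact lt_iSup_iff.1 ht
    · intro a ha b hb
      have h1 : ENNReal.ofReal t ^ 2 < f a * g b := by
        rw [sq]
        exact ENNReal.mul_lt_mul ha hb
      exact lt_of_not_ge fun hle =>
        absurd (pow_le_pow_left' hle 2) (not_le.2 (h1.trans_le (H a b)))
  · have h0 : ∀ {u : ℝ → ENNReal}, ⨆ x, u x = 1 → {x | ENNReal.ofReal t < u x} = ∅ := by
      intro u hu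
      ext x
      simp only [Set.mem_ofPred_eq, Set.mem_empty_iff_false, iff_false]
      intro hx
      exact ht (hx.trans_le (hu ▸ le_iSup u x))
    simp only [h0 hf1, h0 hg1, measure_empty, add_zero, zero_le]

theorem ENNReal.four_mul_mul_le_sq_add (a b : ENNReal) : 4 * (a * b) ≤ (a + b) ^ 2 := by
  induction a with
  | top => simp [sq]
  | coe a =>
    induction b with
    | top => simp [sq]
    | coe b =>
      norm_cast
      rw [← NNReal.coe_le_coe]
      push_cast
      nlinarith [sq_nonneg ((a : ℝ) - b)]

theorem lintegral_mul_lintegral_le_sq_of_iSup_ne_top {f g h : ℝ → ENNReal} (hf : Measurable f)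
    (hg : Measurable g) (hh : Measurable h) (hf1 : ⨆ x, f x ≠ ⊤) (hg1 : ⨆ x, g x ≠ ⊤)
    (H : ∀ x y, f x * g y ≤ h ((1 / 2 : ℝ) * (x + y)) ^ 2) :
    (∫⁻ x, f x) * ∫⁻ x, g x ≤ (∫⁻ x, h x) ^ 2 := by
  set F := ⨆ x, f x with hF
  set G := ⨆ x, g x with hG
  by_cases hF0 : F = 0
  · have : f = 0 := funext fun x => ENNReal.iSup_eq_zero.1 (hF ▸ hF0) x
    simp [this]
  by_cases hG0 : G = 0
  · have : g = 0 := funext fun x => ENNReal.iSup_eq_zero.1 (hG ▸ hG0) x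
    simp [this]
  set r : ENNReal := (F * G) ^ (1 / 2 : ℝ) with hr
  have hr2 : r ^ 2 = F * G := by
    rw [hr, ← ENNReal.rpow_natCast, ← ENNReal.rpow_mul]
    norm_num
  have key := lintegral_add_lintegral_le_of_iSup_eq_one (f := fun x => F⁻¹ * f x)
    (g := fun x => G⁻¹ * g x) (h := fun x => r⁻¹ * h x) (hf.const_mul _) (hg.const_mul _)
    (hh.const_mul _) (by rw [← ENNReal.mul_iSup]; exact ENNReal.inv_mul_cancel hF0 hf1)
    (by rw [← ENNReal.mul_iSup]; exact ENNReal.inv_mul_cancel hG0 hg1) (by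
      intro x y
      calc F⁻¹ * f x * (G⁻¹ * g y) = (F⁻¹ * G⁻¹) * (f x * g y) := by ring
        _ ≤ (F⁻¹ * G⁻¹) * h ((1 / 2 : ℝ) * (x + y)) ^ 2 := by gcongr; exact H x y
        _ = _ := by
          rw [mul_pow, ← ENNReal.inv_pow, hr2, ENNReal.mul_inv (Or.inl hF0) (Or.inl hf1)])
  rw [lintegral_const_mul _ hf, lintegral_const_mul _ hg, lintegral_const_mul _ hh] at key
  have h2 := (ENNReal.four_mul_mul_le_sq_add _ _).trans (pow_le_pow_left' key 2)
  set a := ∫⁻ x, f x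
  set b := ∫⁻ x, g x
  set c := ∫⁻ x, h x
  have h3 : 4 * (F * G)⁻¹ * (a * b) ≤ 4 * (F * G)⁻¹ * c ^ 2 := by
    calc 4 * (F * G)⁻¹ * (a * b) = 4 * (F⁻¹ * a * (G⁻¹ * b)) := by
          rw [ENNReal.mul_inv (Or.inl hF0) (Or.inl hf1)]; ring
      _ ≤ (2 * (r⁻¹ * c)) ^ 2 := h2
      _ = _ := by rw [mul_pow, mul_pow, ← ENNReal.inv_pow, hr2]; ring
  have hFG0 : F * G ≠ 0 := mul_ne_zero hF0 hG0
  have hFGt : F * G ≠ ⊤ := ENNReal.mul_ne_top hf1 hg1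
  refine (ENNReal.mul_le_mul_iff_right ?_ ?_).1 h3
  · exact mul_ne_zero (by norm_num) (ENNReal.inv_ne_zero.2 hFGt)
  · exact ENNReal.mul_ne_top (by norm_num) (ENNReal.inv_ne_top.2 hFG0)

theorem lintegral_mul_lintegral_le_sq_real {f g h : ℝ → ENNReal} (hf : Measurable f)
    (hg : Measurable g) (hh : Measurable h)
    (H : ∀ x y, f x * g y ≤ h ((1 / 2 : ℝ) * (x + y)) ^ 2) :
    (∫⁻ x, f x) * ∫⁻ x, g x ≤ (∫⁻ x, h x) ^ 2 := by
  have htr : ∀ {u : ℝ → ENNReal}, Measurable u →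
      ∫⁻ x, u x = ⨆ n : ℕ, ∫⁻ x, min (u x) n := by
    intro u hu
    rw [← lintegral_iSup (fun n => hu.min measurable_const)]
    · refine lintegral_congr fun x => ?_
      rw [← inf_iSup_eq, ENNReal.iSup_natCast, inf_top_eq]
    · intro m n hmn x
      exact min_le_min le_rfl (by exact_mod_cast hmn)
  have hmono : ∀ u : ℝ → ENNReal, Monotone fun n : ℕ => ∫⁻ x, min (u x) n := by
    intro u m n hmn
    refine lintegral_mono fun x => ?_
    exact min_le_min le_rfl (by exact_mod_cast hmn)
  have hbdd : ∀ (u : ℝ → ENNReal) (n : ℕ), ⨆ x, min (u x) n ≠ ⊤ := fun u n =>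
    ((iSup_le fun x => min_le_right _ _).trans_lt (ENNReal.natCast_lt_top n)).ne
  rw [htr hf, htr hg]
  simp only [ENNReal.iSup_mul, ENNReal.mul_iSup]
  refine iSup_le fun j => iSup_le fun i => ?_
  set n := max i j
  refine (mul_le_mul' (hmono f (le_max_left i j)) (hmono g (le_max_right i j))).trans ?_
  refine lintegral_mul_lintegral_le_sq_of_iSup_ne_top (hf.min measurable_const)
    (hg.min measurable_const) hh (hbdd f n) (hbdd g n) fun x y => ?_
  exact (mul_le_mul' (min_le_left _ _) (min_le_left _ _)).trans (H x y)

theorem MeasureTheory.lintegral_pi_fin_succ {E : Type*} [MeasurableSpace E] (ν : Measure E)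
    [SigmaFinite ν] {n : ℕ} {F : (Fin (n + 1) → E) → ENNReal} (hF : Measurable F) :
    ∫⁻ x, F x ∂(Measure.pi fun _ => ν) =
      ∫⁻ a, ∫⁻ y, F (Fin.cons a y) ∂(Measure.pi fun _ : Fin n => ν) ∂ν := by
  have hmp := (measurePreserving_piFinSuccAbove (fun _ : Fin (n + 1) => ν) 0).symm
  rw [← hmp.lintegral_comp hF,
    lintegral_prod (fun q => F ((MeasurableEquiv.piFinSuccAbove (fun _ => E) 0).symm q))
      (hF.comp (MeasurableEquiv.measurable _)).aemeasurable]
  simp [MeasurableEquiv.piFinSuccAbove_symm_apply, Fin.insertNthEquiv]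

theorem measurable_fin_cons {E : Type*} [MeasurableSpace E] {n : ℕ} :
    Measurable fun q : E × (Fin n → E) => (Fin.cons q.1 q.2 : Fin (n + 1) → E) := by
  refine measurable_pi_lambda _ fun i => ?_
  refine Fin.cases ?_ (fun j => ?_) i
  · exact measurable_fst
  · exact (measurable_pi_apply j).comp measurable_snd

theorem lintegral_mul_lintegral_le_sq_pi {n : ℕ} {f g h : (Fin n → ℝ) → ENNReal}
    (hf : Measurable f) (hg : Measurable g) (hh : Measurable h)
    (H : ∀ x y, f x * g y ≤ h ((1 / 2 : ℝ) • (x + y)) ^ 2) :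
    (∫⁻ x, f x) * ∫⁻ x, g x ≤ (∫⁻ x, h x) ^ 2 := by
  induction n with
  | zero =>
    have h0 : ∀ u : (Fin 0 → ℝ) → ENNReal, ∫⁻ x, u x = u 0 := by
      intro u
      rw [volume_pi, Measure.pi_of_empty (fun _ => volume) 0]
      exact lintegral_dirac _ _
    rw [h0, h0, h0]
    convert H 0 0 using 3

  | succ n ih =>
    have hm : ∀ {u : (Fin (n + 1) → ℝ) → ENNReal}, Measurable u →
        Measurable fun q : ℝ × (Fin n → ℝ) => u (Fin.cons q.1 q.2) :=
      fun hu => hu.comp measurable_fin_cons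
    rw [volume_pi, lintegral_pi_fin_succ _ hf, lintegral_pi_fin_succ _ hg,
      lintegral_pi_fin_succ _ hh]
    refine lintegral_mul_lintegral_le_sq_real (hm hf).lintegral_prod_right'
      (hm hg).lintegral_prod_right' (hm hh).lintegral_prod_right' fun a b => ?_
    refine ih ((hm hf).comp measurable_prodMk_left) ((hm hg).comp measurable_prodMk_left)
      ((hm hh).comp measurable_prodMk_left) fun x y => ?_
    convert H (Fin.cons a x) (Fin.cons b y) using 3
    ext i
    refine Fin.cases ?_ (fun j => ?_) i <;> simp [mul_add]

/-- The multiplicative Brunn-Minkowski inequality for midpoints. -/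
theorem EuclideanSpace.volume_mul_volume_le_sq {n : ℕ} {A B S : Set (EuclideanSpace ℝ (Fin n))}
    (hA : MeasurableSet A) (hB : MeasurableSet B) (hS : MeasurableSet S)
    (h : ∀ a ∈ A, ∀ b ∈ B, (1 / 2 : ℝ) • (a + b) ∈ S) :
    volume A * volume B ≤ volume S ^ 2 := by
  have hmp := PiLp.volume_preserving_toLp (Fin n)
  have hi : ∀ {T : Set (EuclideanSpace ℝ (Fin n))}, MeasurableSet T →
      volume T = ∫⁻ x : Fin n → ℝ, T.indicator 1 (WithLp.toLp 2 x) := by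
    intro T hT
    rw [hmp.lintegral_comp (measurable_one.indicator hT), lintegral_indicator_one hT]
  have hmeas : ∀ {T : Set (EuclideanSpace ℝ (Fin n))}, MeasurableSet T →
      Measurable fun x : Fin n → ℝ =>
        (T.indicator 1 (WithLp.toLp 2 x : EuclideanSpace ℝ (Fin n)) : ENNReal) :=
    fun hT => (measurable_one.indicator hT).comp hmp.measurable
  rw [hi hA, hi hB, hi hS]
  refine lintegral_mul_lintegral_le_sq_pi (hmeas hA) (hmeas hB) (hmeas hS) fun x y => ?_
  by_cases hx : WithLp.toLp 2 x ∈ A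
  · by_cases hy : WithLp.toLp 2 y ∈ B
    · have := h _ hx _ hy
      rw [← WithLp.toLp_add, ← WithLp.toLp_smul] at this
      rw [Set.indicator_of_mem hx, Set.indicator_of_mem hy, Set.indicator_of_mem this]
      simp
    · simp [hy]
  · simp [hx]

/-- A measure is midpoint log-concave if `ν A * ν B ≤ ν S ^ 2` whenever `S` contains all midpoints
of points of `A` with points of `B`. -/
def IsMidpointLogConcave {E : Type*} [AddCommGroup E] [Module ℝ E] [MeasurableSpace E]
    (ν : Measure E) : Prop :=
  ∀ A B S : Set E, MeasurableSet A → MeasurableSet B → MeasurableSet S →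
    (∀ a ∈ A, ∀ b ∈ B, (1 / 2 : ℝ) • (a + b) ∈ S) → ν A * ν B ≤ ν S ^ 2

/-- The midpoint triangle inequality satisfied by absolute values of affine functions. -/
def MidpointSubadditive {E : Type*} [AddCommGroup E] [Module ℝ E] (g : E → ENNReal) : Prop :=
  ∀ a b, g a ≤ 2 * g ((1 / 2 : ℝ) • (a + b)) + g b

theorem measure_lt_le_two_inv_pow {E : Type*} [AddCommGroup E] [Module ℝ E] [MeasurableSpace E]
    {ν : Measure E} [IsProbabilityMeasure ν] (hν : IsMidpointLogConcave ν) {g : E → ENNReal}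
    (hg : Measurable g) (hQ : MidpointSubadditive g) {t : ENNReal} (ht : t ≠ ⊤)
    (h0 : ν {x | t < g x} ≤ 2⁻¹ ^ 2) (k : ℕ) :
    ν {x | 3 ^ k * t < g x} ≤ 2⁻¹ ^ (2 ^ k + 1) := by
  induction k with
  | zero => simpa using h0
  | succ k ih =>
    set s := 3 ^ k * t with hs
    have hst : s ≠ ⊤ := ENNReal.mul_ne_top (by simp) ht
    have hm : ∀ r : ENNReal, MeasurableSet {x | r < g x} := fun r =>
      measurableSet_lt measurable_const hg
    have h1 : ν {x | 3 * s < g x} * ν {x | s < g x}ᶜ ≤ ν {x | s < g x} ^ 2 := by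
      refine hν _ _ _ (hm _) (hm _).compl (hm _) fun a ha b hb => ?_
      simp only [Set.mem_ofPred_eq, Set.mem_compl_iff, not_lt] at ha hb ⊢
      by_contra! hle
      refine absurd (ha.trans_le (hQ a b)) (not_lt.2 ?_)
      calc 2 * g ((1 / 2 : ℝ) • (a + b)) + g b ≤ 2 * s + s := by gcongr
        _ = 3 * s := by ring
    have hq : ν {x | s < g x} ≤ 2⁻¹ := by
      refine ih.trans ?_
      calc (2⁻¹ : ENNReal) ^ (2 ^ k + 1) ≤ 2⁻¹ ^ 1 :=
            pow_le_pow_right_of_le_one' (by simp) (Nat.le_add_left 1 _)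
        _ = 2⁻¹ := pow_one _
    have hc : (2⁻¹ : ENNReal) ≤ ν {x | s < g x}ᶜ := by
      rw [prob_compl_eq_one_sub (hm _)]
      calc (2⁻¹ : ENNReal) = 1 - 2⁻¹ := by simp
        _ ≤ _ := tsub_le_tsub_left hq 1
    have h3 : (3 : ENNReal) ^ (k + 1) * t = 3 * s := by rw [hs]; ring
    rw [h3]
    have h4 : ν {x | 3 * s < g x} * 2⁻¹ ≤ (2⁻¹ ^ (2 ^ k + 1)) ^ 2 :=
      (mul_le_mul_right hc _).trans (h1.trans (pow_le_pow_left' ih 2))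
    calc ν {x | 3 * s < g x} = ν {x | 3 * s < g x} * 2⁻¹ * 2 := by
          rw [mul_assoc, ENNReal.inv_mul_cancel (by simp) (by simp), mul_one]
      _ ≤ (2⁻¹ ^ (2 ^ k + 1)) ^ 2 * 2 := by gcongr
      _ = 2⁻¹ ^ (2 ^ (k + 1) + 1) * (2⁻¹ * 2) := by ring
      _ = _ := by rw [ENNReal.inv_mul_cancel (by simp) (by simp), mul_one]

/-- The constant in the reverse Hölder inequality. -/
noncomputable def reverseHolderConst (p : ℝ) : ENNReal :=
  4 ^ p * (1 + ∑' k : ℕ, (3 ^ (k + 1)) ^ p * 2⁻¹ ^ (2 ^ k + 1))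

theorem reverseHolderConst_ne_top {p : ℝ} (hp : 0 ≤ p) : reverseHolderConst p ≠ ⊤ := by
  refine ENNReal.mul_ne_top (ENNReal.rpow_ne_top_of_nonneg hp (by simp)) ?_
  refine ENNReal.add_ne_top.2 ⟨by simp, ?_⟩
  set u : ℕ → ℝ := fun k => ((3 : ℝ) ^ (k + 1)) ^ p * 2⁻¹ ^ (2 ^ k + 1) with hu
  have hpos : ∀ k, 0 < u k := fun k => by positivity
  have hs : Summable u := by
    refine summable_of_ratio_test_tendsto_lt_one (l := 0) (by norm_num)
      (Filter.Eventually.of_forall fun k => (hpos k).ne') ?_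
    have h1 : ∀ k, ‖u (k + 1)‖ / ‖u k‖ = 3 ^ p * 2⁻¹ ^ (2 ^ k) := by
      intro k
      rw [Real.norm_of_nonneg (hpos _).le, Real.norm_of_nonneg (hpos _).le,
        div_eq_iff (hpos k).ne']
      simp only [hu]
      rw [pow_succ (3 : ℝ) (k + 1), Real.mul_rpow (by positivity) (by positivity)]
      ring
    simp only [h1]
    rw [show (0 : ℝ) = 3 ^ p * 0 by simp]
    refine Filter.Tendsto.const_mul _ ?_
    exact (tendsto_pow_atTop_nhds_zero_of_lt_one (by norm_num) (by norm_num)).comp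
      (tendsto_pow_atTop_atTop_of_one_lt (by norm_num))
  have h2 : ∀ k : ℕ, ((3 : ENNReal) ^ (k + 1)) ^ p * 2⁻¹ ^ (2 ^ k + 1) = ENNReal.ofReal (u k) := by
    intro k
    simp only [hu]
    rw [ENNReal.ofReal_mul (by positivity), ← ENNReal.ofReal_rpow_of_nonneg (by positivity) hp,
      ENNReal.ofReal_pow (by norm_num), ENNReal.ofReal_pow (by norm_num),
      ENNReal.ofReal_inv_of_pos (by norm_num)]
    simp
  simp only [h2]
  exact hs.tsum_ofReal_ne_top

theorem one_le_reverseHolderConst {p : ℝ} (hp : 0 ≤ p) : 1 ≤ reverseHolderConst p := by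
  calc (1 : ENNReal) = 1 * 1 := by simp
    _ ≤ _ := mul_le_mul'
      (by simpa using ENNReal.rpow_le_rpow (show (1 : ENNReal) ≤ 4 by norm_num) hp) le_self_add

theorem rpow_le_add_tsum_indicator {p : ℝ} (hp : 0 < p) {t : ENNReal} (ht0 : t ≠ 0)
    (c : ENNReal) :
    c ^ p ≤ t ^ p + ∑' k : ℕ, (3 ^ (k + 1) * t) ^ p * {k : ℕ | 3 ^ k * t < c}.indicator 1 k := by
  by_cases hc : c ≤ t
  · exact (ENNReal.rpow_le_rpow hc hp.le).trans le_self_add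
  push Not at hc
  by_cases hall : ∃ k : ℕ, c ≤ 3 ^ (k + 1) * t
  · classical
    set k := Nat.find hall with hk
    have hk1 : c ≤ 3 ^ (k + 1) * t := Nat.find_spec hall
    have hk2 : 3 ^ k * t < c := by
      rcases Nat.eq_zero_or_pos k with h | h
      · simpa [h] using hc
      · have := Nat.find_min hall (m := k - 1) (by omega)
        rw [Nat.sub_add_cancel h] at this
        exact not_le.1 this
    refine le_trans ?_ le_add_self
    refine le_trans ?_ (ENNReal.le_tsum k)
    rw [Set.indicator_of_mem (by exact hk2)]
    simpa using ENNReal.rpow_le_rpow hk1 hp.le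
  · push Not at hall
    have : ∑' k : ℕ, (3 ^ (k + 1) * t) ^ p * {k : ℕ | 3 ^ k * t < c}.indicator 1 k = ⊤ := by
      refine top_le_iff.1 ?_
      have h1 : ∑' _ : ℕ, t ^ p = ⊤ :=
        ENNReal.tsum_const_eq_top_of_ne_zero (by simp [ENNReal.rpow_eq_zero_iff, ht0, hp.not_gt])
      rw [← h1]
      refine ENNReal.tsum_le_tsum fun k => ?_
      have hk : 3 ^ k * t < c := by
        refine lt_of_le_of_lt ?_ (hall k)
        gcongr
        · norm_num
        · omega
      rw [Set.indicator_of_mem (by exact hk)]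
      simp only [Pi.one_apply, mul_one]
      refine ENNReal.rpow_le_rpow ?_ hp.le
      exact le_mul_of_one_le_left' (one_le_pow_of_one_le' (by norm_num) _)
    rw [this]
    simp

theorem lintegral_rpow_le_reverseHolderConst_mul {E : Type*} [AddCommGroup E] [Module ℝ E]
    [MeasurableSpace E] {ν : Measure E} [IsProbabilityMeasure ν] (hν : IsMidpointLogConcave ν)
    {p : ℝ} (hp : 1 ≤ p) {g : E → ENNReal} (hg : Measurable g) (hQ : MidpointSubadditive g) :
    ∫⁻ x, g x ^ p ∂ν ≤ reverseHolderConst p * (∫⁻ x, g x ∂ν) ^ p := by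
  have hp0 : 0 < p := by linarith
  set m := ∫⁻ x, g x ∂ν with hm
  by_cases hmt : m = ⊤
  · rw [hmt, ENNReal.top_rpow_of_pos hp0, ENNReal.mul_top]
    · exact le_top
    · exact (zero_lt_one.trans_le (one_le_reverseHolderConst hp0.le)).ne'
  by_cases hm0 : m = 0
  · have h1 : g =ᵐ[ν] 0 := (lintegral_eq_zero_iff hg).1 hm0
    have h2 : ∫⁻ x, g x ^ p ∂ν = 0 := by
      rw [lintegral_eq_zero_iff (hg.pow_const _)]
      filter_upwards [h1] with x hx
      simp [hx, hp0]
    rw [h2]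
    exact zero_le
  set t := 4 * m with ht
  have ht0 : t ≠ 0 := mul_ne_zero (by norm_num) hm0
  have htt : t ≠ ⊤ := ENNReal.mul_ne_top (by norm_num) hmt
  have h0 : ν {x | t < g x} ≤ 2⁻¹ ^ 2 := by
    calc ν {x | t < g x} ≤ ν {x | t ≤ g x} := measure_mono fun x (hx : t < g x) => hx.le
      _ ≤ m / t := meas_ge_le_lintegral_div hg.aemeasurable ht0 htt
      _ = 2⁻¹ ^ 2 := by
        rw [ht, ENNReal.div_eq_inv_mul, ENNReal.mul_inv (by simp) (by simp), mul_assoc,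
          ENNReal.inv_mul_cancel hm0 hmt, mul_one, ← ENNReal.inv_pow]
        norm_num
  have hms : ∀ k : ℕ, MeasurableSet {x | 3 ^ k * t < g x} := fun k =>
    measurableSet_lt measurable_const hg
  calc ∫⁻ x, g x ^ p ∂ν
      ≤ ∫⁻ x, (t ^ p + ∑' k : ℕ, (3 ^ (k + 1) * t) ^ p *
          {x | 3 ^ k * t < g x}.indicator 1 x) ∂ν :=
        lintegral_mono fun x => rpow_le_add_tsum_indicator hp0 ht0 (g x)
    _ = t ^ p + ∑' k : ℕ, (3 ^ (k + 1) * t) ^ p * ν {x | 3 ^ k * t < g x} := by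
        rw [lintegral_add_left measurable_const, lintegral_const, measure_univ, mul_one,
          lintegral_tsum fun k => ((measurable_one.indicator (hms k)).const_mul _).aemeasurable]
        congr 1
        refine tsum_congr fun k => ?_
        rw [lintegral_const_mul _ (measurable_one.indicator (hms k)),
          lintegral_indicator_one (hms k)]
    _ ≤ t ^ p + ∑' k : ℕ, (3 ^ (k + 1) * t) ^ p * 2⁻¹ ^ (2 ^ k + 1) := by
        gcongr with k
        exact measure_lt_le_two_inv_pow hν hg hQ htt h0 k
    _ = t ^ p + ∑' k : ℕ, t ^ p * ((3 ^ (k + 1)) ^ p * 2⁻¹ ^ (2 ^ k + 1)) := by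
        congr 1
        refine tsum_congr fun k => ?_
        rw [ENNReal.mul_rpow_of_nonneg _ _ hp0.le]
        ring
    _ = reverseHolderConst p * m ^ p := by
        rw [ENNReal.tsum_mul_left, ht, ENNReal.mul_rpow_of_nonneg _ _ hp0.le, reverseHolderConst]
        ring

theorem lintegral_pi_rpow_le_reverseHolderConst_pow_mul {E : Type*} [AddCommGroup E] [Module ℝ E]
    [MeasurableSpace E] {ν : Measure E} [IsProbabilityMeasure ν] (hν : IsMidpointLogConcave ν)
    {p : ℝ} (hp : 1 ≤ p) {n : ℕ} {F : (Fin n → E) → ENNReal} (hF : Measurable F)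
    (hQ : ∀ i x, MidpointSubadditive fun a => F (Function.update x i a)) :
    ∫⁻ x, F x ^ p ∂(Measure.pi fun _ => ν) ≤
      reverseHolderConst p ^ n * (∫⁻ x, F x ∂(Measure.pi fun _ => ν)) ^ p := by
  induction n with
  | zero =>
    rw [Measure.pi_of_empty (fun _ => ν) finZeroElim, lintegral_dirac, lintegral_dirac]
    simp
  | succ n ih =>
    have hm : Measurable fun q : E × (Fin n → E) => F (Fin.cons q.1 q.2) :=
      hF.comp measurable_fin_cons
    have hG : Measurable fun a => ∫⁻ y, F (Fin.cons a y) ∂(Measure.pi fun _ : Fin n => ν) :=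
      hm.lintegral_prod_right'
    rw [lintegral_pi_fin_succ ν hF, lintegral_pi_fin_succ ν (hF.pow_const p)]
    calc ∫⁻ a, ∫⁻ y, F (Fin.cons a y) ^ p ∂(Measure.pi fun _ : Fin n => ν) ∂ν
        ≤ ∫⁻ a, reverseHolderConst p ^ n *
            (∫⁻ y, F (Fin.cons a y) ∂(Measure.pi fun _ : Fin n => ν)) ^ p ∂ν := by
          refine lintegral_mono fun a => ih (hm.comp measurable_prodMk_left) fun i x => ?_
          simpa only [Fin.cons_update] using hQ i.succ (Fin.cons a x)
      _ = reverseHolderConst p ^ n *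
            ∫⁻ a, (∫⁻ y, F (Fin.cons a y) ∂(Measure.pi fun _ : Fin n => ν)) ^ p ∂ν :=
          lintegral_const_mul _ (hG.pow_const p)
      _ ≤ reverseHolderConst p ^ n * (reverseHolderConst p *
            (∫⁻ a, ∫⁻ y, F (Fin.cons a y) ∂(Measure.pi fun _ : Fin n => ν) ∂ν) ^ p) := by
          gcongr
          refine lintegral_rpow_le_reverseHolderConst_mul hν hp hG fun a b => ?_
          have hmy : ∀ c : E, Measurable fun y : Fin n → E => F (Fin.cons c y) :=
            fun c => hm.comp measurable_prodMk_left
          rw [← lintegral_const_mul _ (hmy _), ← lintegral_add_left ((hmy _).const_mul _)]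
          refine lintegral_mono fun y => ?_
          simpa only [Fin.update_cons_zero] using hQ 0 (Fin.cons a y) a b
      _ = _ := by rw [pow_succ, mul_assoc]

theorem integral_det_sq_pi {ι E : Type*} [Fintype ι] [DecidableEq ι] [MeasurableSpace E]
    (ν : Measure E) [SigmaFinite ν] {y : ι → E → ℝ}
    (hy : ∀ k l, Integrable (fun x => y k x * y l x) ν) :
    ∫ X : ι → E, (Matrix.of fun i k => y k (X i)).det ^ 2 ∂(Measure.pi fun _ => ν) =
      (Fintype.card ι).factorial * (Matrix.of fun k l => ∫ x, y k x * y l x ∂ν).det := by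
  set B : Matrix ι ι ℝ := Matrix.of fun k l => ∫ x, y k x * y l x ∂ν with hB
  have h1 : ∀ X : ι → E, (Matrix.of fun i k => y k (X i)).det ^ 2 =
      ∑ σ : Equiv.Perm ι, ∑ τ : Equiv.Perm ι, ((Equiv.Perm.sign σ : ℤ) : ℝ) *
        ((Equiv.Perm.sign τ : ℤ) : ℝ) * ∏ i, (y (σ i) (X i) * y (τ i) (X i)) := by
    intro X
    rw [← Matrix.det_transpose, Matrix.det_apply', sq, Finset.sum_mul_sum]
    refine Finset.sum_congr rfl fun σ _ => Finset.sum_congr rfl fun τ _ => ?_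
    rw [Finset.prod_mul_distrib]
    simp only [Matrix.transpose_apply, Matrix.of_apply]
    ring
  have hint : ∀ σ τ : Equiv.Perm ι, Integrable
      (fun X : ι → E => ∏ i, (y (σ i) (X i) * y (τ i) (X i))) (Measure.pi fun _ => ν) :=
    fun σ τ => Integrable.fintype_prod (f := fun i x => y (σ i) x * y (τ i) x)
      fun i => hy (σ i) (τ i)
  simp only [h1]
  rw [integral_finsetSum _ fun σ _ => integrable_finsetSum _ fun τ _ => (hint σ τ).const_mul _]
  have h2 : ∀ σ : Equiv.Perm ι, ∫ X : ι → E, ∑ τ : Equiv.Perm ι, ((Equiv.Perm.sign σ : ℤ) : ℝ) *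
        ((Equiv.Perm.sign τ : ℤ) : ℝ) * ∏ i, (y (σ i) (X i) * y (τ i) (X i))
        ∂(Measure.pi fun _ => ν) = B.det := by
    intro σ
    rw [integral_finsetSum _ fun τ _ => (hint σ τ).const_mul _]
    have h3 : ∀ τ : Equiv.Perm ι, ∫ X : ι → E, ((Equiv.Perm.sign σ : ℤ) : ℝ) *
        ((Equiv.Perm.sign τ : ℤ) : ℝ) * ∏ i, (y (σ i) (X i) * y (τ i) (X i))
        ∂(Measure.pi fun _ => ν) = ((Equiv.Perm.sign σ : ℤ) : ℝ) *
        (((Equiv.Perm.sign τ : ℤ) : ℝ) * ∏ i, (B.submatrix σ id).transpose (τ i) i) := by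
      intro τ
      rw [integral_const_mul, mul_assoc,
        integral_fintype_prod_eq_prod (f := fun i x => y (σ i) x * y (τ i) x)]
      rfl
    simp only [h3]
    rw [← Finset.mul_sum, ← Matrix.det_apply', Matrix.det_transpose, Matrix.det_permute,
      ← mul_assoc]
    have : ((Equiv.Perm.sign σ : ℤ) : ℝ) * ((Equiv.Perm.sign σ : ℤ) : ℝ) = 1 := by
      norm_cast
      simp
    rw [this, one_mul]
  simp only [h2]
  simp [Fintype.card_perm]

theorem Matrix.det_eq_det_of_zero_row {d : ℕ} {R : Type*} [CommRing R]
    (B : Matrix (Fin (d + 1)) (Fin (d + 1)) R) (h0 : B 0 0 = 1) (h : ∀ j : Fin d, B 0 j.succ = 0) :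
    B.det = (B.submatrix Fin.succ Fin.succ).det := by
  rw [Matrix.det_succ_row_zero, Fin.sum_univ_succ]
  simp [h0, h]

/-- The matrix whose rows are the vectors `(1, X i - c)`. -/
def augMatrix {d : ℕ} (c : EuclideanSpace ℝ (Fin d)) (X : Fin (d + 1) → EuclideanSpace ℝ (Fin d)) :
    Matrix (Fin (d + 1)) (Fin (d + 1)) ℝ :=
  Matrix.of fun i k => Fin.cons (α := fun _ => ℝ) 1 (fun j => X i j - c j) k

theorem det_augMatrix {d : ℕ} (c : EuclideanSpace ℝ (Fin d))
    (X : Fin (d + 1) → EuclideanSpace ℝ (Fin d)) :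
    (augMatrix c X).det = (Matrix.of fun j i : Fin d => X i.succ j - X 0 j).det := by
  set B : Matrix (Fin (d + 1)) (Fin (d + 1)) ℝ := Matrix.of fun i k =>
    Fin.cases (augMatrix c X 0 k) (fun i => augMatrix c X i.succ k - augMatrix c X 0 k) i with hB
  have h1 : (augMatrix c X).det = B.det := by
    refine Matrix.det_eq_of_forall_row_eq_smul_add_const (fun i => if i = 0 then 0 else 1) 0
      (by simp) fun i k => ?_
    refine Fin.cases ?_ (fun i => ?_) i <;> simp [hB]
  rw [h1, ← Matrix.det_transpose, Matrix.det_eq_det_of_zero_row]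
  · congr 1
    ext j i
    simp [hB, augMatrix]
  · simp [hB, augMatrix]
  · simp [hB, augMatrix]

theorem continuous_det_augMatrix {d : ℕ} (c : EuclideanSpace ℝ (Fin d)) :
    Continuous fun X => (augMatrix c X).det := by
  simp only [det_augMatrix]
  refine Continuous.matrix_det (continuous_matrix fun i j => ?_)
  simp only [Matrix.of_apply]
  fun_prop

theorem midpointSubadditive_det_augMatrix {d : ℕ} (c : EuclideanSpace ℝ (Fin d))
    (i : Fin (d + 1)) (X : Fin (d + 1) → EuclideanSpace ℝ (Fin d)) :
    MidpointSubadditive fun a =>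
      ENNReal.ofReal |(augMatrix c (Function.update X i a)).det| := by
  intro a b
  set r : EuclideanSpace ℝ (Fin d) → Fin (d + 1) → ℝ := fun a =>
    Fin.cons (α := fun _ => ℝ) 1 (fun j => a j - c j) with hr
  have hup : ∀ a, augMatrix c (Function.update X i a) = (augMatrix c X).updateRow i (r a) := by
    intro a
    ext k l
    by_cases hk : k = i
    · subst hk
      simp [augMatrix, hr]
    · simp [augMatrix, hk]
  have hrow : r a + r b = (2 : ℝ) • r ((1 / 2 : ℝ) • (a + b)) := by
    ext l
    refine Fin.cases ?_ (fun l => ?_) l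
    · simp only [hr, Pi.add_apply, Pi.smul_apply, Fin.cons_zero]
      norm_num
    · simp only [hr, Pi.add_apply, Pi.smul_apply, Fin.cons_succ, PiLp.smul_apply, PiLp.add_apply,
        smul_eq_mul]
      ring
  have hdet := congrArg (fun v => ((augMatrix c X).updateRow i v).det) hrow
  simp only [Matrix.det_updateRow_add, Matrix.det_updateRow_smul, ← hup] at hdet
  set u := (augMatrix c (Function.update X i a)).det
  set v := (augMatrix c (Function.update X i b)).det
  set w := (augMatrix c (Function.update X i ((1 / 2 : ℝ) • (a + b)))).det
  show ENNReal.ofReal |u| ≤ 2 * ENNReal.ofReal |w| + ENNReal.ofReal |v|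
  have h2 : (2 : ENNReal) = ENNReal.ofReal 2 := by simp
  rw [h2, ← ENNReal.ofReal_mul (by norm_num), ← ENNReal.ofReal_add (by positivity) (by positivity)]
  refine ENNReal.ofReal_le_ofReal ?_
  have : u = 2 * w - v := by linarith
  rw [this]
  refine (abs_sub _ _).trans ?_
  rw [abs_mul, abs_two]

/-- The volume of the standard simplex. -/
noncomputable def stdSimplexVolume (d : ℕ) : ℝ :=
  (volume (convexHull ℝ (Set.range (Fin.cons (α := fun _ => EuclideanSpace ℝ (Fin d)) 0
    (EuclideanSpace.basisFun (Fin d) ℝ))))).toReal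

theorem stdSimplexVolume_pos (d : ℕ) : 0 < stdSimplexVolume d := by
  set v : Fin (d + 1) → EuclideanSpace ℝ (Fin d) :=
    Fin.cons (α := fun _ => EuclideanSpace ℝ (Fin d)) 0 (EuclideanSpace.basisFun (Fin d) ℝ) with hv
  have hcomp : IsCompact (convexHull ℝ (Set.range v)) := (Set.finite_range v).isCompact_convexHull ℝ
  refine ENNReal.toReal_pos ?_ hcomp.measure_lt_top.ne
  have hint : (interior (convexHull ℝ (Set.range v))).Nonempty := by
    rw [interior_convexHull_nonempty_iff_affineSpan_eq_top]
    have h0 : (0 : EuclideanSpace ℝ (Fin d)) ∈ Set.range v := ⟨0, by simp [hv]⟩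
    rw [AffineSubspace.affineSpan_eq_top_iff_vectorSpan_eq_top_of_nonempty _ _ _ ⟨0, h0⟩,
      vectorSpan_eq_span_vsub_set_right ℝ h0, eq_top_iff,
      ← (EuclideanSpace.basisFun (Fin d) ℝ).toBasis.span_eq]
    refine Submodule.span_mono ?_
    rintro _ ⟨i, rfl⟩
    exact ⟨v i.succ, ⟨i.succ, rfl⟩, by simp [hv]⟩
  exact (Measure.measure_pos_of_nonempty_interior _ hint).ne'

theorem volume_convexHull_range_toReal {d : ℕ} (c : EuclideanSpace ℝ (Fin d))
    (X : Fin (d + 1) → EuclideanSpace ℝ (Fin d)) :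
    (volume (convexHull ℝ (Set.range X))).toReal =
      stdSimplexVolume d * |(augMatrix c X).det| := by
  set v : Fin (d + 1) → EuclideanSpace ℝ (Fin d) :=
    Fin.cons (α := fun _ => EuclideanSpace ℝ (Fin d)) 0 (EuclideanSpace.basisFun (Fin d) ℝ) with hv
  set b := (EuclideanSpace.basisFun (Fin d) ℝ).toBasis with hb
  set N : Matrix (Fin d) (Fin d) ℝ := Matrix.of fun j i : Fin d => X i.succ j - X 0 j with hN
  set L := Matrix.toLin b b N with hL
  have hX : X = fun i => X 0 + L (v i) := by
    funext i
    refine Fin.cases ?_ (fun i => ?_) i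
    · simp [hv]
    · have h1 : v i.succ = b i := by simp [hv, hb]
      rw [h1, hL, Matrix.toLin_self]
      ext j
      simp [hN, hb, Finset.sum_apply, Pi.single_apply]
  have hrange : Set.range X = (fun x => X 0 + x) '' (L '' Set.range v) := by
    conv_lhs => rw [hX]
    rw [← Set.range_comp, ← Set.range_comp]
    rfl
  have hconv : convexHull ℝ (Set.range X) =
      (fun x => X 0 + x) '' (L '' convexHull ℝ (Set.range v)) := by
    rw [hrange, LinearMap.image_convexHull]
    exact convexHull_vadd (X 0) (L '' Set.range v)
  have hvol : volume ((fun x => X 0 + x) '' (L '' convexHull ℝ (Set.range v))) =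
      volume (L '' convexHull ℝ (Set.range v)) := by simp
  rw [hconv, hvol, Measure.addHaar_image_linearMap, hL, LinearMap.det_toLin, det_augMatrix,
    ENNReal.toReal_mul, ENNReal.toReal_ofReal (abs_nonneg _), mul_comm]
  rfl

section UniformMeasure

variable {d : ℕ} {K : Set (EuclideanSpace ℝ (Fin d))}

theorem IsConvexBody.measurableSet (hK : IsConvexBody K) : MeasurableSet K :=
  hK.1.measurableSet

theorem IsConvexBody.volume_ne_zero (hK : IsConvexBody K) : volume K ≠ 0 :=
  (Measure.measure_pos_of_nonempty_interior _ hK.2.2).ne'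

theorem IsConvexBody.volume_ne_top (hK : IsConvexBody K) : volume K ≠ ⊤ :=
  hK.1.measure_lt_top.ne

theorem IsConvexBody.isProbabilityMeasure_cond (hK : IsConvexBody K) :
    IsProbabilityMeasure (ProbabilityTheory.cond volume K) :=
  ProbabilityTheory.cond_isProbabilityMeasure_of_finite hK.volume_ne_zero hK.volume_ne_top

theorem IsConvexBody.isMidpointLogConcave_cond (hK : IsConvexBody K) :
    IsMidpointLogConcave (ProbabilityTheory.cond volume K) := by
  intro A B S hA hB hS h
  rw [ProbabilityTheory.cond_apply hK.measurableSet, ProbabilityTheory.cond_apply hK.measurableSet,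
    ProbabilityTheory.cond_apply hK.measurableSet]
  have key := EuclideanSpace.volume_mul_volume_le_sq (hK.measurableSet.inter hA)
    (hK.measurableSet.inter hB) (hK.measurableSet.inter hS) fun a ha b hb =>
      ⟨by
        rw [smul_add]
        exact hK.2.1 ha.1 hb.1 (by norm_num) (by norm_num) (by norm_num), h a ha.2 b hb.2⟩
  calc (volume K)⁻¹ * volume (K ∩ A) * ((volume K)⁻¹ * volume (K ∩ B))
      = (volume K)⁻¹ ^ 2 * (volume (K ∩ A) * volume (K ∩ B)) := by ring
    _ ≤ (volume K)⁻¹ ^ 2 * volume (K ∩ S) ^ 2 := by gcongr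
    _ = _ := by ring

theorem IsConvexBody.cond_pi_eq (hK : IsConvexBody K) (n : ℕ) :
    ProbabilityTheory.cond volume (Set.univ.pi fun _ : Fin n => K) =
      Measure.pi fun _ : Fin n => ProbabilityTheory.cond volume K := by
  have := hK.isProbabilityMeasure_cond
  refine (Measure.pi_eq fun s hs => ?_).symm
  rw [ProbabilityTheory.cond_apply (MeasurableSet.univ_pi fun _ => hK.measurableSet),
    ← Set.pi_inter_distrib, volume_pi_pi, volume_pi_pi]
  simp only [ProbabilityTheory.cond_apply hK.measurableSet]
  rw [Finset.prod_mul_distrib]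
  simp [ENNReal.inv_pow]

theorem IsConvexBody.integrable_pi_cond (hK : IsConvexBody K) {n : ℕ}
    {f : (Fin n → EuclideanSpace ℝ (Fin d)) → ℝ} (hf : Continuous f) :
    Integrable f (Measure.pi fun _ => ProbabilityTheory.cond volume K) := by
  rw [← hK.cond_pi_eq, ProbabilityTheory.cond]
  refine Integrable.smul_measure ?_ ?_
  · exact hf.continuousOn.integrableOn_compact (isCompact_univ_pi fun _ => hK.1)
  · rw [volume_pi_pi]
    simpa using fun h => absurd h hK.volume_ne_zero

theorem IsConvexBody.integrable_cond (hK : IsConvexBody K) {F : Type*} [NormedAddCommGroup F]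
    {f : EuclideanSpace ℝ (Fin d) → F} (hf : Continuous f) :
    Integrable f (ProbabilityTheory.cond volume K) :=
  (hf.continuousOn.integrableOn_compact hK.1).smul_measure (ENNReal.inv_ne_top.2 hK.volume_ne_zero)

/-- The `r`-th absolute moment of the determinant of the matrix with rows `(1, X i - μ(K))` for
independent uniformly random points `X i` of `K`. -/
noncomputable def absDetMoment (r : ℝ) (K : Set (EuclideanSpace ℝ (Fin d))) : ℝ :=
  ∫ X, |(augMatrix (centroid K) X).det| ^ r
    ∂(Measure.pi fun _ : Fin (d + 1) => ProbabilityTheory.cond volume K)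

theorem absDetMoment_nonneg (r : ℝ) (K : Set (EuclideanSpace ℝ (Fin d))) :
    0 ≤ absDetMoment r K :=
  integral_nonneg fun _ => by positivity

theorem IsConvexBody.integrable_abs_det_rpow (hK : IsConvexBody K) {r : ℝ} (hr : 0 ≤ r)
    (c : EuclideanSpace ℝ (Fin d)) :
    Integrable (fun X : Fin (d + 1) → EuclideanSpace ℝ (Fin d) => |(augMatrix c X).det| ^ r)
      (Measure.pi fun _ => ProbabilityTheory.cond volume K) :=
  hK.integrable_pi_cond ((continuous_det_augMatrix c).abs.rpow_const fun _ => Or.inr hr)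

theorem IsConvexBody.absDetMoment_one_rpow_le (hK : IsConvexBody K) {r : ℝ} (hr : 1 ≤ r) :
    absDetMoment 1 K ^ r ≤ absDetMoment r K := by
  have := hK.isProbabilityMeasure_cond
  have h1 := hK.integrable_abs_det_rpow zero_le_one (centroid K)
  have hr2 := hK.integrable_abs_det_rpow (zero_le_one.trans hr) (centroid K)
  simp only [Real.rpow_one] at h1
  have := (convexOn_rpow hr).map_integral_le
    (Real.continuous_rpow_const (zero_le_one.trans hr)).continuousOn isClosed_Ici
    (Filter.Eventually.of_forall fun X => abs_nonneg (augMatrix (centroid K) X).det) h1 hr2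
  simpa only [absDetMoment, Real.rpow_one] using this

theorem IsConvexBody.absDetMoment_le (hK : IsConvexBody K) {r : ℝ} (hr : 1 ≤ r) :
    absDetMoment r K ≤
      (reverseHolderConst r).toReal ^ (d + 1) * absDetMoment 1 K ^ r := by
  have := hK.isProbabilityMeasure_cond
  have hr0 : 0 ≤ r := zero_le_one.trans hr
  have hof : ∀ s : ℝ, 0 ≤ s → ENNReal.ofReal (absDetMoment s K) =
      ∫⁻ X, ENNReal.ofReal |(augMatrix (centroid K) X).det| ^ s
        ∂(Measure.pi fun _ : Fin (d + 1) => ProbabilityTheory.cond volume K) := by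
    intro s hs
    rw [absDetMoment, ofReal_integral_eq_lintegral_ofReal (hK.integrable_abs_det_rpow hs _)
      (Filter.Eventually.of_forall fun X => by positivity)]
    refine lintegral_congr fun X => ?_
    rw [ENNReal.ofReal_rpow_of_nonneg (abs_nonneg _) hs]
  have key := lintegral_pi_rpow_le_reverseHolderConst_pow_mul hK.isMidpointLogConcave_cond hr
    (F := fun X => ENNReal.ofReal |(augMatrix (centroid K) X).det|)
    (continuous_det_augMatrix (centroid K)).abs.measurable.ennreal_ofReal
    (midpointSubadditive_det_augMatrix (centroid K))
  have h1 := hof 1 zero_le_one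
  simp only [ENNReal.rpow_one] at h1
  rw [← hof r hr0, ← h1, ENNReal.ofReal_rpow_of_nonneg (absDetMoment_nonneg _ _) hr0,
    ← ENNReal.ofReal_toReal (reverseHolderConst_ne_top hr0),
    ← ENNReal.ofReal_pow ENNReal.toReal_nonneg, ← ENNReal.ofReal_mul (by positivity)] at key
  refine (ENNReal.ofReal_le_ofReal_iff ?_).1 key
  exact mul_nonneg (by positivity) (Real.rpow_nonneg (absDetMoment_nonneg _ _) _)

theorem IsConvexBody.momentVolSimplexReal_eq (hK : IsConvexBody K) (p : ℝ) :
    momentVolSimplexReal d p K = stdSimplexVolume d ^ p * absDetMoment p K := by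
  have h : momentVolSimplexReal d p K =
      ∫ X, (volume (convexHull ℝ (Set.range X))).toReal ^ p
        ∂(Measure.pi fun _ : Fin (d + 1) => ProbabilityTheory.cond volume K) := by
    rw [momentVolSimplexReal, setAverage_eq', ← hK.cond_pi_eq]
    rfl
  rw [h, absDetMoment, ← integral_const_mul]
  refine integral_congr_ae (Filter.Eventually.of_forall fun X => ?_)
  simp only
  rw [volume_convexHull_range_toReal (centroid K) X,
    Real.mul_rpow (stdSimplexVolume_pos d).le (abs_nonneg _)]

theorem IsConvexBody.absDetMoment_two_eq (hK : IsConvexBody K) :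
    absDetMoment 2 K = (d + 1).factorial * (covMatrix K).det := by
  have := hK.isProbabilityMeasure_cond
  set y : Fin (d + 1) → EuclideanSpace ℝ (Fin d) → ℝ := fun k x =>
    Fin.cons (α := fun _ => ℝ) 1 (fun j => x j - centroid K j) k with hy
  have hcont : ∀ k, Continuous (y k) := by
    intro k
    refine Fin.cases ?_ (fun j => ?_) k
    · simp only [hy, Fin.cons_zero]
      fun_prop
    · simp only [hy, Fin.cons_succ]
      fun_prop
  have h1 : absDetMoment 2 K = ∫ X : Fin (d + 1) → EuclideanSpace ℝ (Fin d),
      (Matrix.of fun i k => y k (X i)).det ^ 2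
        ∂(Measure.pi fun _ => ProbabilityTheory.cond volume K) := by
    rw [absDetMoment]
    refine integral_congr_ae (Filter.Eventually.of_forall fun X => ?_)
    simp only [Real.rpow_two, sq_abs]
    rfl
  rw [h1, integral_det_sq_pi _ fun k l => hK.integrable_cond ((hcont k).mul (hcont l)),
    Fintype.card_fin]
  congr 1
  have hcov : ∀ f : EuclideanSpace ℝ (Fin d) → ℝ,
      ⨍ x in K, f x = ∫ x, f x ∂(ProbabilityTheory.cond volume K) := by
    intro f
    rw [setAverage_eq']
    rfl
  rw [Matrix.det_eq_det_of_zero_row]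
  · congr 1
    ext i j
    simp [covMatrix, hcov, hy]
  · simp [hy]
  · intro j
    have hc : centroid K j = ∫ x : EuclideanSpace ℝ (Fin d), x j
        ∂(ProbabilityTheory.cond volume K) := by
      have := (EuclideanSpace.proj (𝕜 := ℝ) j : EuclideanSpace ℝ (Fin d) →L[ℝ] ℝ).integral_comp_comm
        (hK.integrable_cond continuous_id)
      simp only [id, EuclideanSpace.coe_proj] at this
      rw [this, centroid, setAverage_eq']
      rfl
    simp only [hy, Matrix.of_apply, Fin.cons_zero, Fin.cons_succ, one_mul]
    rw [integral_sub (hK.integrable_cond (by fun_prop)) (integrable_const _), ← hc]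
    simp

end UniformMeasure

/-- Weak monotonicity under inclusion only depends on a functional up to exponential factors,
dimensional constants and powers. -/
theorem weak_monotonicity_iff_of_comparable
    {a X : ∀ d : ℕ, Set (EuclideanSpace ℝ (Fin d)) → ℝ} {r C : ℝ} (hr : 0 < r) (hC : 1 ≤ C)
    {T : ℕ → ℝ} (hT : ∀ d, 0 < T d) (ha : ∀ d K, 0 ≤ a d K)
    (hlow : ∀ d K, IsConvexBody K → T d * a d K ^ r ≤ X d K)
    (hup : ∀ d K, IsConvexBody K → X d K ≤ T d * (C ^ (d + 1) * a d K ^ r)) :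
    (∃ c : ℝ, 0 < c ∧ ∀ (d : ℕ), 0 < d → ∀ K M : Set (EuclideanSpace ℝ (Fin d)),
      IsConvexBody K → IsConvexBody M → K ⊆ M → X d K ≤ c ^ d * X d M) ↔
    (∃ c : ℝ, 0 < c ∧ ∀ (d : ℕ), 0 < d → ∀ K M : Set (EuclideanSpace ℝ (Fin d)),
      IsConvexBody K → IsConvexBody M → K ⊆ M → a d K ≤ c ^ d * a d M) := by
  have hC0 : 0 < C := zero_lt_one.trans_le hC
  have hCd : ∀ d : ℕ, 0 < d → C ^ (d + 1) ≤ (C ^ 2) ^ d := by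
    intro d hd
    rw [← pow_mul]
    exact pow_le_pow_right₀ hC (by omega)
  constructor
  · rintro ⟨c, hc, h⟩
    refine ⟨(c * C ^ 2) ^ r⁻¹, by positivity, fun d hd K M hK hM hKM => ?_⟩
    have hM0 := ha d M
    have h1 : T d * a d K ^ r ≤ T d * ((c * C ^ 2) ^ d * a d M ^ r) :=
      calc T d * a d K ^ r ≤ X d K := hlow d K hK
        _ ≤ c ^ d * X d M := h d hd K M hK hM hKM
        _ ≤ c ^ d * (T d * (C ^ (d + 1) * a d M ^ r)) := by gcongr; exact hup d M hM
        _ ≤ c ^ d * (T d * ((C ^ 2) ^ d * a d M ^ r)) := by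
          have := (hT d).le
          gcongr
          exact hCd d hd
        _ = _ := by ring
    have h2 := le_of_mul_le_mul_left h1 (hT d)
    refine (Real.rpow_le_rpow_iff (ha d K) (by positivity) hr).1 (h2.trans_eq ?_)
    rw [Real.mul_rpow (by positivity) hM0, ← Real.rpow_natCast (_ ^ r⁻¹) d,
      ← Real.rpow_mul (by positivity), ← Real.rpow_mul (by positivity),
      mul_left_comm, inv_mul_cancel₀ hr.ne', mul_one, Real.rpow_natCast]
  · rintro ⟨c, hc, h⟩
    refine ⟨C ^ 2 * c ^ r, by positivity, fun d hd K M hK hM hKM => ?_⟩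
    have hM0 := ha d M
    have hK0 := ha d K
    have hTd := (hT d).le
    calc X d K ≤ T d * (C ^ (d + 1) * a d K ^ r) := hup d K hK
      _ ≤ T d * ((C ^ 2) ^ d * (c ^ d * a d M) ^ r) := by
        gcongr
        · exact hCd d hd
        · exact h d hd K M hK hM hKM
      _ = (C ^ 2 * c ^ r) ^ d * (T d * a d M ^ r) := by
        rw [Real.mul_rpow (by positivity) hM0, ← Real.rpow_natCast c d, ← Real.rpow_mul hc.le,
          mul_comm (d : ℝ) r, Real.rpow_mul hc.le, Real.rpow_natCast]
        ring
      _ ≤ (C ^ 2 * c ^ r) ^ d * X d M := by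
        gcongr
        exact hlow d M hM

/-- For a fixed `1 ≤ p < ∞`, the weak (exponential-in-`d`) monotonicity of
`det A(·)` under inclusion is equivalent to the weak monotonicity of the `p`-th
moment of the volume of a random simplex. -/
theorem weak_monotonicity_det_cov_iff_weak_monotonicity_moment
    (p : ℝ) (hp : 1 ≤ p) :
    (∃ c₁ : ℝ, 0 < c₁ ∧ ∀ (d : ℕ), 0 < d →
      ∀ K M : Set (EuclideanSpace ℝ (Fin d)),
        IsConvexBody K → IsConvexBody M → K ⊆ M →
        (covMatrix K).det ≤ c₁ ^ d * (covMatrix M).det) ↔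
    (∃ c₂ : ℝ, 0 < c₂ ∧ ∀ (d : ℕ), 0 < d →
      ∀ K M : Set (EuclideanSpace ℝ (Fin d)),
        IsConvexBody K → IsConvexBody M → K ⊆ M →
        momentVolSimplexReal d p K ≤ c₂ ^ d * momentVolSimplexReal d p M) := by
  have hC : ∀ {r : ℝ}, 0 ≤ r → 1 ≤ (reverseHolderConst r).toReal := fun hr =>
    by
    simpa using ENNReal.toReal_mono (reverseHolderConst_ne_top hr) (one_le_reverseHolderConst hr)
  have hdet := weak_monotonicity_iff_of_comparable
    (a := fun d K => absDetMoment (d := d) 1 K) (X := fun d K => (covMatrix (d := d) K).det)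
    (T := fun d => ((d + 1).factorial : ℝ)⁻¹) (r := 2) two_pos (hC zero_le_two)
    (fun d => by positivity) (fun d K => absDetMoment_nonneg 1 K)
    (fun d K hK => by
      have h := hK.absDetMoment_one_rpow_le one_le_two
      rw [hK.absDetMoment_two_eq] at h
      rw [inv_mul_le_iff₀ (by positivity)]
      exact h)
    (fun d K hK => by
      have h := hK.absDetMoment_le one_le_two
      rw [hK.absDetMoment_two_eq] at h
      rw [le_inv_mul_iff₀ (by positivity)]
      exact h)
  have hmom := weak_monotonicity_iff_of_comparable
    (a := fun d K => absDetMoment (d := d) 1 K) (X := fun d K => momentVolSimplexReal d p K)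
    (T := fun d => stdSimplexVolume d ^ p) (r := p) (zero_lt_one.trans_le hp)
    (hC (zero_le_one.trans hp)) (fun d => Real.rpow_pos_of_pos (stdSimplexVolume_pos d) p)
    (fun d K => absDetMoment_nonneg 1 K)
    (fun d K hK => by
      rw [hK.momentVolSimplexReal_eq]
      exact mul_le_mul_of_nonneg_left (hK.absDetMoment_one_rpow_le hp)
        (Real.rpow_nonneg (stdSimplexVolume_pos d).le p))
    (fun d K hK => by
      rw [hK.momentVolSimplexReal_eq]
      exact mul_le_mul_of_nonneg_left (hK.absDetMoment_le hp)
        (Real.rpow_nonneg (stdSimplexVolume_pos d).le p))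
  exact hdet.trans hmom.symm
end
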